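/- arXiv:1710.07255 — 2 statements merged into one kernel-verified Lean document; each statement's English description precedes it below -/
import Mathlib

section
/- Let k ≥ 1 and let H be a nonempty induced subgraph of the hypercube Q_k such that |V(H)| is a power of 2. Then there exists an integer n₀ = n₀(H) such that for all n ≥ n₀, the hypercube Q_n admits a perfect induced H-packing. -/
/-- The hypercube `Q_n`: vertices are functions `Fin n → ZMod 2`, adjacent iff they
differ in exactly one coordinate. -/
def cube (n : ℕ) : SimpleGraph (Fin n → ZMod 2) :=
  SimpleGraph.fromRel fun u v => ∃ i, u i ≠ v i ∧ ∀ j, j ≠ i → u j = v j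

/-- `G` admits a perfect induced `H`-packing. -/
def HasPerfectInducedPacking {V W : Type*} (G : SimpleGraph V) (H : SimpleGraph W) : Prop :=
  ∃ P : Set G.Subgraph,
    (∀ K ∈ P, K.IsInduced ∧ Nonempty (H ≃g K.coe)) ∧
    P.PairwiseDisjoint (fun K => K.verts) ∧
    ⋃ K ∈ P, K.verts = Set.univ

/-- A type identified with the cube on a finite set of coordinates. -/
class CubeLike (α : Type) where
  Coord : Type
  [fintypeCoord : Fintype Coord]
  toCube : α ≃ (Coord → ZMod 2)

namespace CubeLike

attribute [reducible, instance] fintypeCoord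

instance pi (ι : Type) [Fintype ι] : CubeLike (ι → ZMod 2) where
  Coord := ι
  toCube := Equiv.refl _

instance prod (α β : Type) [CubeLike α] [CubeLike β] : CubeLike (α × β) where
  Coord := Coord α ⊕ Coord β
  toCube := (Equiv.prodCongr toCube toCube).trans (Equiv.sumArrowEquivProdArrow _ _ _).symm

variable {α β γ J : Type} [CubeLike α] [CubeLike β] [CubeLike γ]

/-- The Hamming distance of a cube. -/
def cdist (x y : α) : ℕ := hammingDist (toCube x) (toCube y)

theorem cdist_pi {ι : Type} [Fintype ι] (x y : ι → ZMod 2) : cdist x y = hammingDist x y := rfl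

theorem cdist_self (x : α) : cdist x x = 0 := hammingDist_self _

theorem cdist_eq_zero {x y : α} : cdist x y = 0 ↔ x = y := by
  simp [cdist, hammingDist_eq_zero]

theorem cdist_prod (x y : α × β) : cdist x y = cdist x.1 y.1 + cdist x.2 y.2 := by
  simp only [cdist, hammingDist, Finset.card_filter]
  exact Fintype.sum_sum_type _

theorem finite (α : Type) [CubeLike α] : Finite α := Finite.of_equiv _ (toCube (α := α)).symm

end CubeLike

open CubeLike

section Tileable

variable {k : ℕ} (X : Set (Fin k → ZMod 2))
variable {α β γ J : Type} [CubeLike α] [CubeLike β] [CubeLike γ]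

/-- `B` is an isometric copy of `X`. -/
def IsCopy (B : Set α) : Prop :=
  ∃ f : (Fin k → ZMod 2) → α,
    (∀ x ∈ X, ∀ y ∈ X, cdist (f x) (f y) = hammingDist x y) ∧ f '' X = B

/-- `A` can be partitioned into isometric copies of `X`. -/
def Tileable (A : Set α) : Prop :=
  ∃ P : Set (Set α), (∀ B ∈ P, IsCopy X B) ∧ P.PairwiseDisjoint id ∧ ⋃₀ P = A

variable {X}

theorem IsCopy.tileable {B : Set α} (h : IsCopy X B) : Tileable X B :=
  ⟨{B}, by simpa using h, Set.pairwiseDisjoint_singleton _ _, by simp⟩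

theorem Tileable.congr {A B : Set α} (hA : Tileable X A) (h : ∀ x, x ∈ A ↔ x ∈ B) :
    Tileable X B :=
  Set.ext h ▸ hA

theorem Tileable.empty : Tileable X (∅ : Set α) :=
  ⟨∅, by simp, Set.pairwiseDisjoint_empty, by simp⟩

theorem Tileable.iUnion {A : J → Set α} (h : ∀ j, Tileable X (A j))
    (hd : Pairwise fun i j => Disjoint (A i) (A j)) : Tileable X (⋃ j, A j) := by
  choose P hP hdisj hU using h
  refine ⟨⋃ j, P j, ?_, ?_, ?_⟩
  · intro B hB
    obtain ⟨j, hj⟩ := Set.mem_iUnion.1 hB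
    exact hP j B hj
  · intro B hB C hC hne
    obtain ⟨i, hi⟩ := Set.mem_iUnion.1 hB
    obtain ⟨j, hj⟩ := Set.mem_iUnion.1 hC
    by_cases hij : i = j
    · subst hij
      exact hdisj i hi hj hne
    · refine (hd hij).mono ?_ ?_
      · rw [← hU i]; exact Set.subset_sUnion_of_mem hi
      · rw [← hU j]; exact Set.subset_sUnion_of_mem hj
  · rw [Set.sUnion_iUnion]
    exact Set.iUnion_congr hU

theorem Tileable.union {A B : Set α} (hA : Tileable X A) (hB : Tileable X B)
    (hd : Disjoint A B) : Tileable X (A ∪ B) := by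
  rw [Set.union_eq_iUnion]
  refine Tileable.iUnion (by rintro (_ | _) <;> assumption) ?_
  rintro (_ | _) (_ | _) h
  exacts [(h rfl).elim, hd.symm, hd, (h rfl).elim]

theorem Tileable.image {A : Set α} (hA : Tileable X A) {f : α → β}
    (hf : ∀ x y, cdist (f x) (f y) = cdist x y) : Tileable X (f '' A) := by
  have hinj : Function.Injective f := fun x y h => by
    rw [← cdist_eq_zero, ← hf, h, cdist_self]
  obtain ⟨P, hP, hd, rfl⟩ := hA
  refine ⟨(f '' ·) '' P, ?_, ?_, ?_⟩
  · rintro _ ⟨B, hB, rfl⟩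
    obtain ⟨g, hg, rfl⟩ := hP B hB
    exact ⟨f ∘ g, fun x hx y hy => (hf _ _).trans (hg x hx y hy), Set.image_comp _ _ _⟩
  · rintro _ ⟨B, hB, rfl⟩ _ ⟨C, hC, rfl⟩ hne
    exact (Set.disjoint_image_iff hinj).2 (hd hB hC fun h => hne (by rw [h]))
  · exact (Set.image_sUnion).symm

theorem Tileable.of_fibers (e : J × α ≃ γ)
    (he : ∀ j x y, cdist (e (j, x)) (e (j, y)) = cdist x y) {A : Set γ}
    (h : ∀ j, Tileable X {x | e (j, x) ∈ A}) : Tileable X A := by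
  have hA : A = ⋃ j, (fun x => e (j, x)) '' {x | e (j, x) ∈ A} := by
    ext z
    obtain ⟨⟨j, x⟩, rfl⟩ := e.surjective z
    simp [Prod.ext_iff]
  rw [hA]
  refine Tileable.iUnion (fun j => (h j).image (he j)) fun i j hij => ?_
  simp only [Set.disjoint_left]
  rintro _ ⟨x, -, rfl⟩ ⟨y, -, hy⟩
  exact hij (congrArg Prod.fst (e.injective hy)).symm

theorem Tileable.of_right {A : Set (α × β)} (h : ∀ a, Tileable X {b | (a, b) ∈ A}) :
    Tileable X A :=
  Tileable.of_fibers (Equiv.refl _) (fun j x y => by simp [cdist_prod, cdist_self]) h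

theorem Tileable.of_left {A : Set (α × β)} (h : ∀ b, Tileable X {a | (a, b) ∈ A}) :
    Tileable X A :=
  Tileable.of_fibers (Equiv.prodComm _ _) (fun j x y => by simp [cdist_prod, cdist_self]) h

theorem Tileable.sep {A : Set α} (hA : Tileable X A) (p : Prop) :
    Tileable X {a | a ∈ A ∧ p} := by
  by_cases hp : p
  · simpa [hp] using hA
  · simpa [hp] using Tileable.empty

end Tileable

section Covers

variable {k : ℕ} {X : Set (Fin k → ZMod 2)}

theorem exists_two_cover_of_finset {U : Type} [CubeLike U]
    (hU : ∀ p : U, ∃ T : Set U, Tileable X T ∧ p ∈ T) (s : Finset U) :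
    ∃ (V : Type) (_ : CubeLike V) (N : Set U → Set V),
      N Set.univ = Set.univ ∧
      (∀ p, ∃ D : Set V, Tileable X D ∧ ∀ Y, N (insert p Y) ⊆ N Y ∪ D) ∧
      ∃ A B : Set V, Tileable X A ∧ Tileable X B ∧ N s ⊆ A ∪ B := by
  classical
  induction s using Finset.induction_on with
  | empty =>
    refine ⟨U, inferInstance, id, rfl, fun p => ?_, ∅, ∅, .empty, .empty, by simp⟩
    obtain ⟨T, hT, hp⟩ := hU p
    refine ⟨T, hT, fun Y y hy => ?_⟩
    rcases hy with rfl | hy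
    exacts [Or.inr hp, Or.inl hy]
  | insert p s _ ih =>
    obtain ⟨V, _, N, hN, hD, A, B, hA, hB, hs⟩ := ih
    refine ⟨V × V, inferInstance, fun Y => N Y ×ˢ N Y, by simp [hN], fun q => ?_, ?_⟩
    · obtain ⟨D, hDt, hDN⟩ := hD q
      refine ⟨{z | z.1 ∈ D} ∪ {z | z.1 ∉ D ∧ z.2 ∈ D}, ?_, ?_⟩
      · refine .union (.of_left fun b => hDt) (.of_right fun a => ?_) ?_
        · simpa [and_comm] using hDt.sep (a ∉ D)
        · rw [Set.disjoint_left]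
          simp only [Set.mem_ofPred_eq]
          tauto
      · rintro Y ⟨x, y⟩ ⟨hx, hy⟩
        have h1 := hDN Y hx
        have h2 := hDN Y hy
        simp only [Set.mem_union, Set.mem_prod, Set.mem_ofPred_eq] at *
        tauto
    · obtain ⟨D, hDt, hDN⟩ := hD p
      refine ⟨{z | z.1 ∈ A} ∪ {z | z.1 ∉ A ∧ (z.1 ∈ A ∪ B → z.2 ∈ A) ∧ (z.1 ∉ A ∪ B → z.2 ∈ D)},
        {z | z.2 ∈ B} ∪ {z | z.2 ∉ B ∧ (z.2 ∈ A ∪ B → z.1 ∈ D) ∧ (z.2 ∉ A ∪ B → z.1 ∈ B)},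
        ?_, ?_, ?_⟩
      · refine .union (.of_left fun b => hA) (.of_right fun a => ?_) ?_
        · by_cases h : a ∈ A ∪ B
          · exact (hA.sep (a ∉ A)).congr fun b => by
              simp only [Set.mem_union, Set.mem_ofPred_eq] at h ⊢
              tauto
          · exact (hDt.sep (a ∉ A)).congr fun b => by
              simp only [Set.mem_union, Set.mem_ofPred_eq] at h ⊢
              tauto
        · rw [Set.disjoint_left]
          simp only [Set.mem_ofPred_eq]
          tauto
      · refine .union (.of_right fun b => hB) (.of_left fun a => ?_) ?_
        · by_cases h : a ∈ A ∪ B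
          · exact (hDt.sep (a ∉ B)).congr fun b => by
              simp only [Set.mem_union, Set.mem_ofPred_eq] at h ⊢
              tauto
          · exact (hB.sep (a ∉ B)).congr fun b => by
              simp only [Set.mem_union, Set.mem_ofPred_eq] at h ⊢
              tauto
        · rw [Set.disjoint_left]
          simp only [Set.mem_ofPred_eq]
          tauto
      · rintro ⟨x, y⟩ ⟨hx, hy⟩
        rw [Finset.coe_insert] at hx hy
        have h1 := hDN _ hx
        have h2 := hDN _ hy
        have h3 : x ∈ N s → x ∈ A ∪ B := fun h => hs h
        have h4 : y ∈ N s → y ∈ A ∪ B := fun h => hs h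
        simp only [Set.mem_union, Set.mem_ofPred_eq] at *
        tauto

theorem exists_two_cover {U : Type} [CubeLike U]
    (hU : ∀ p : U, ∃ T : Set U, Tileable X T ∧ p ∈ T) :
    ∃ (V : Type) (_ : CubeLike V) (A B : Set V),
      Tileable X A ∧ Tileable X B ∧ A ∪ B = Set.univ := by
  have := CubeLike.finite U
  have := Fintype.ofFinite U
  obtain ⟨V, _, N, hN, -, A, B, hA, hB, hs⟩ := exists_two_cover_of_finset hU Finset.univ
  rw [Finset.coe_univ, hN] at hs
  exact ⟨V, _, A, B, hA, hB, Set.univ_subset_iff.1 hs⟩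

theorem exists_isCopy_mem (hX : X.Nonempty) (p : Fin k → ZMod 2) :
    ∃ T : Set (Fin k → ZMod 2), Tileable X T ∧ p ∈ T := by
  obtain ⟨x, hx⟩ := hX
  refine ⟨(fun y => y + (p - x)) '' X, IsCopy.tileable ⟨_, fun y _ z _ => ?_, rfl⟩, x, hx, by simp⟩
  simp [cdist_pi, hammingDist]

end Covers

section Conn

variable {k : ℕ} (X : Set (Fin k → ZMod 2))
variable {α β γ U : Type} [CubeLike α] [CubeLike β] [CubeLike γ] [CubeLike U]

/-- `B` arises from `A` by adding a disjoint tileable set. -/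
def TileStep (A B : Set α) : Prop :=
  ∃ T, Tileable X T ∧ Disjoint A T ∧ B = A ∪ T

/-- `A` and `B` differ by adding and removing finitely many tileable sets. -/
def TileConn : Set α → Set α → Prop := Relation.EqvGen (TileStep X)

/-- After passing to a product, the complement of a thickened complement of `A` is tileable. -/
def Absorbable (A : Set α) : Prop :=
  ∃ (β : Type) (_ : CubeLike β) (K : Set β), Tileable X {z : α × β | z.1 ∈ A ∨ z.2 ∉ K}

variable {X}

theorem TileStep.conn {A B : Set α} (h : TileStep X A B) : TileConn X A B := Relation.EqvGen.rel _ _ h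

theorem TileConn.refl (A : Set α) : TileConn X A A := Relation.EqvGen.refl _

theorem TileConn.symm {A B : Set α} (h : TileConn X A B) : TileConn X B A := Relation.EqvGen.symm _ _ h

theorem TileConn.trans {A B C : Set α} (h : TileConn X A B) (h' : TileConn X B C) :
    TileConn X A C := Relation.EqvGen.trans _ _ _ h h'

theorem Tileable.conn_empty {A : Set α} (h : Tileable X A) : TileConn X ∅ A :=
  TileStep.conn ⟨A, h, by simp, by simp⟩

theorem TileConn.map {A B : Set α} (F : Set α → Set β)
    (hF : ∀ A B, TileStep X A B → TileStep X (F A) (F B)) (h : TileConn X A B) :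
    TileConn X (F A) (F B) := by
  induction h with
  | rel A B h => exact (hF A B h).conn
  | refl A => exact TileConn.refl _
  | symm A B _ ih => exact ih.symm
  | trans A B C _ _ ih ih' => exact ih.trans ih'

theorem TileConn.of_slices {A B : α → Set β} (h : ∀ a, TileConn X (A a) (B a)) :
    TileConn X {z : α × β | z.2 ∈ A z.1} {z : α × β | z.2 ∈ B z.1} := by
  classical
  have := CubeLike.finite α
  have := Fintype.ofFinite α
  suffices H : ∀ s : Finset α, TileConn X {z : α × β | z.2 ∈ A z.1}
      {z : α × β | (z.1 ∈ s → z.2 ∈ B z.1) ∧ (z.1 ∉ s → z.2 ∈ A z.1)} by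
    simpa using H Finset.univ
  intro s
  induction s using Finset.induction_on with
  | empty => simpa using TileConn.refl _
  | insert a s ha ih =>
    refine ih.trans ?_
    have key := (h a).map (fun Y => {z : α × β | (z.1 = a → z.2 ∈ Y) ∧
      (z.1 ≠ a → z ∈ {z : α × β | (z.1 ∈ s → z.2 ∈ B z.1) ∧ (z.1 ∉ s → z.2 ∈ A z.1)})}) ?_
    · convert key using 1
      · ext ⟨x, y⟩
        simp only [Set.mem_ofPred_eq]
        by_cases hx : x = a
        · subst hx; simp [ha]
        · simp [hx]
      · ext ⟨x, y⟩
        simp only [Set.mem_ofPred_eq, Finset.mem_insert]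
        by_cases hx : x = a
        · subst hx; simp
        · simp [hx]
    · rintro Y Z ⟨T, hT, hd, rfl⟩
      refine ⟨{z | z.2 ∈ T ∧ z.1 = a}, .of_right fun x => hT.sep (x = a), ?_, ?_⟩
      · rw [Set.disjoint_left] at hd ⊢
        rintro ⟨x, y⟩ hz ⟨hy, rfl⟩
        exact hd (hz.1 rfl) hy
      · ext ⟨x, y⟩
        simp only [Set.mem_ofPred_eq, Set.mem_union]
        tauto

theorem absorbable_iff_of_step {T₁ T₂ : Set U} (h₁ : Tileable X T₁) (h₂ : Tileable X T₂)
    (h : T₁ ∪ T₂ = Set.univ) {A B : Set α} (hAB : TileStep X A B) :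
    Absorbable X A ↔ Absorbable X B := by
  obtain ⟨T, hT, hd, rfl⟩ := hAB
  rw [Set.disjoint_left] at hd
  have h' : ∀ u, u ∈ T₁ ∨ u ∈ T₂ := fun u => by simpa using h.ge (Set.mem_univ u)
  constructor
  · rintro ⟨β, _, K, hK⟩
    refine ⟨β, _, K, (hK.union (B := {z : α × β | z.1 ∈ T ∧ z.2 ∈ K})
      (.of_left fun b => hT.sep (b ∈ K)) ?_).congr fun z => ?_⟩
    · rw [Set.disjoint_left]
      rintro z (hz | hz) ⟨h1, h2⟩
      exacts [hd hz h1, hz h2]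
    · simp only [Set.mem_ofPred_eq, Set.mem_union]
      tauto
  · rintro ⟨β, _, K, hK⟩
    refine ⟨β × U, inferInstance, {z | z.1 ∈ K ∧ z.2 ∉ T₁}, ?_⟩
    have hi : Tileable X {z : α × β × U | z.2.2 ∉ T₂ ∧ (z.1 ∈ A ∪ T ∨ z.2.1 ∉ K)} := by
      refine .of_fibers (J := U) ((Equiv.prodComm _ _).trans (Equiv.prodAssoc α β U)) ?_ fun u => ?_
      · intro j x y
        simp [cdist_prod, cdist_self]
      · exact (hK.sep (u ∉ T₂)).congr fun z => and_comm
    have hii : Tileable X {z : α × β × U | z.1 ∈ T ∧ z.2.1 ∈ K ∧ z.2.2 ∈ T₁ ∧ z.2.2 ∈ T₂} :=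
      .of_left fun z => hT.sep (z.1 ∈ K ∧ z.2 ∈ T₁ ∧ z.2 ∈ T₂)
    have hiii : Tileable X {z : α × β × U |
        ((z.1 ∈ A ∨ z.2.1 ∉ K) ∧ z.2.2 ∈ T₂) ∨ (z.1 ∉ A ∪ T ∧ z.2.1 ∈ K ∧ z.2.2 ∈ T₁)} := by
      refine .of_right fun a => .of_right fun b => ?_
      by_cases hab : a ∈ A ∨ b ∉ K
      · refine h₂.congr fun u => ?_
        simp only [Set.mem_ofPred_eq, Set.mem_union]
        tauto
      · refine (h₁.sep (a ∉ T)).congr fun u => ?_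
        simp only [Set.mem_ofPred_eq, Set.mem_union]
        tauto
    refine ((hi.union hii ?_).union hiii ?_).congr fun z => ?_
    · rw [Set.disjoint_left]
      simp only [Set.mem_ofPred_eq, Set.mem_union]
      tauto
    · rw [Set.disjoint_left]
      intro z
      have := @hd z.1
      simp only [Set.mem_ofPred_eq, Set.mem_union]
      tauto
    · have := h' z.2.2
      have := @hd z.1
      simp only [Set.mem_ofPred_eq, Set.mem_union]
      tauto

theorem TileConn.exists_tileable_univ {T₁ T₂ : Set U} (h₁ : Tileable X T₁) (h₂ : Tileable X T₂)
    (h : T₁ ∪ T₂ = Set.univ) (hc : TileConn X (∅ : Set α) Set.univ) :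
    ∃ (β : Type) (_ : CubeLike β), Tileable X (Set.univ : Set (α × β)) := by
  have key : ∀ A B : Set α, TileConn X A B → (Absorbable X A ↔ Absorbable X B) := by
    intro A B hAB
    induction hAB with
    | rel A B hAB => exact absorbable_iff_of_step h₁ h₂ h hAB
    | refl => rfl
    | symm _ _ _ ih => exact ih.symm
    | trans _ _ _ _ _ ih ih' => exact ih.trans ih'
  have h0 : Absorbable X (∅ : Set α) :=
    ⟨Fin 0 → ZMod 2, inferInstance, Set.univ, Tileable.empty.congr (by simp)⟩
  obtain ⟨β, _, K, hK⟩ := (key _ _ hc).1 h0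
  exact ⟨β, _, hK.congr (by simp)⟩

end Conn

section Path

variable {k : ℕ} {X : Set (Fin k → ZMod 2)}
variable {α β U : Type} [CubeLike α] [CubeLike β] [CubeLike U]

theorem exists_path_map {T₁ T₂ : Set U} (h₁ : Tileable X T₁) (h₂ : Tileable X T₂)
    (h : T₁ ∪ T₂ = Set.univ) (j : ℕ) :
    ∃ (β : Type) (_ : CubeLike β) (ℓ : β → ℕ), (∀ b, ℓ b < 2 * j + 1) ∧
      ∀ i, i + 1 < 2 * j + 1 → Tileable X {b | ℓ b = i ∨ ℓ b = i + 1} := by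
  classical
  have h' : ∀ u, u ∈ T₁ ∨ u ∈ T₂ := fun u => by simpa using h.ge (Set.mem_univ u)
  induction j with
  | zero => exact ⟨Fin 0 → ZMod 2, inferInstance, fun _ => 0, by simp, by omega⟩
  | succ j ih =>
    obtain ⟨β, _, ℓ, hℓ, ht⟩ := ih
    refine ⟨β × U, inferInstance, fun z => if ℓ z.1 < 2 * j then ℓ z.1 else
      if z.2 ∉ T₂ then 2 * j else if z.2 ∈ T₁ then 2 * j + 1 else 2 * j + 2,
      fun z => ?_, fun i hi => ?_⟩
    · have := hℓ z.1
      dsimp only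
      split_ifs <;> omega
    · rcases (by omega : i + 1 < 2 * j ∨ i + 1 = 2 * j ∨ i = 2 * j ∨ i = 2 * j + 1) with
        hi | hi | rfl | rfl
      · refine .of_left fun u => (ht i (by omega)).congr fun b => ?_
        have := hℓ b
        simp only [Set.mem_ofPred_eq]
        split_ifs <;> omega
      · refine (Tileable.union (A := {z : β × U | (ℓ z.1 = i ∨ ℓ z.1 = i + 1) ∧ z.2 ∉ T₂})
          (B := {z : β × U | z.2 ∈ T₂ ∧ ℓ z.1 = i}) (.of_left fun u => (ht i (by omega)).sep (u ∉ T₂))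
          (.of_right fun b => h₂.sep (ℓ b = i)) ?_).congr fun z => ?_
        · rw [Set.disjoint_left]
          simp only [Set.mem_ofPred_eq]
          tauto
        · have := hℓ z.1
          simp only [Set.mem_ofPred_eq, Set.mem_union]
          grind
      · refine .of_right fun b => (h₁.sep (ℓ b = 2 * j)).congr fun u => ?_
        have := hℓ b
        have := h' u
        simp only [Set.mem_ofPred_eq]
        grind
      · refine .of_right fun b => (h₂.sep (ℓ b = 2 * j)).congr fun u => ?_
        have := hℓ b
        have := h' u
        simp only [Set.mem_ofPred_eq]
        grind

theorem tileConn_comp_perm {n : ℕ} {ℓ : β → Fin (n + 1)}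
    (hℓ : ∀ i : Fin n, Tileable X {b | ℓ b = i.castSucc ∨ ℓ b = i.succ})
    (σ : Equiv.Perm (Fin (n + 1))) (p : Fin (n + 1) → Prop) :
    TileConn X {b | p (ℓ b) ↔ Even (ℓ b : ℕ)} {b | p (σ (ℓ b)) ↔ Even (ℓ b : ℕ)} := by
  have hσ : σ ∈ Submonoid.closure
      (Set.range fun i : Fin n => Equiv.swap i.castSucc i.succ) := by
    rw [Equiv.Perm.mclosure_swap_castSucc_succ]; trivial
  induction hσ using Submonoid.closure_induction generalizing p with
  | one => exact .refl _
  | mul σ τ _ _ ih ih' => exact (ih p).trans (ih' fun i => p (σ i))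
  | mem σ hσ =>
    obtain ⟨i, rfl⟩ := hσ
    have hne : i.castSucc ≠ i.succ := i.castSucc_lt_succ.ne
    have hs : ∀ b, (ℓ b = i.castSucc ∧ ℓ b ≠ i.succ ∧
          Equiv.swap i.castSucc i.succ (ℓ b) = i.succ ∧ (Even (ℓ b : ℕ) ↔ Even (i : ℕ))) ∨
        (ℓ b = i.succ ∧ ℓ b ≠ i.castSucc ∧
          Equiv.swap i.castSucc i.succ (ℓ b) = i.castSucc ∧ (Even (ℓ b : ℕ) ↔ ¬ Even (i : ℕ))) ∨
        (ℓ b ≠ i.castSucc ∧ ℓ b ≠ i.succ ∧ Equiv.swap i.castSucc i.succ (ℓ b) = ℓ b) := by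
      intro b
      by_cases h1 : ℓ b = i.castSucc
      · left; simp [h1, hne]
      by_cases h2 : ℓ b = i.succ
      · right; left; simp [h2, hne.symm, Nat.even_add_one]
      · right; right; exact ⟨h1, h2, Equiv.swap_apply_of_ne_of_ne h1 h2⟩
    by_cases hp : p i.castSucc ↔ p i.succ
    · convert TileConn.refl _ using 1
      ext b
      simp only [Set.mem_ofPred_eq]
      rcases hs b with h | h | h
      · rw [h.2.2.1, h.1]; tauto
      · rw [h.2.2.1, h.1]; tauto
      · rw [h.2.2]
    by_cases hi : p i.castSucc ↔ Even (i : ℕ)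
    · refine (TileStep.conn ⟨_, hℓ i, ?_, ?_⟩).symm
      · rw [Set.disjoint_left]
        intro b
        simp only [Set.mem_ofPred_eq]
        rcases hs b with h | h | h
        · rw [h.2.2.1, h.2.2.2]; tauto
        · rw [h.2.2.1, h.2.2.2]; tauto
        · tauto
      · ext b
        simp only [Set.mem_ofPred_eq, Set.mem_union]
        rcases hs b with h | h | h
        · rw [h.2.2.1, h.2.2.2, h.1]; tauto
        · rw [h.2.2.1, h.2.2.2, h.1]; tauto
        · rw [h.2.2]; tauto
    · refine TileStep.conn ⟨_, hℓ i, ?_, ?_⟩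
      · rw [Set.disjoint_left]
        intro b
        simp only [Set.mem_ofPred_eq]
        rcases hs b with h | h | h
        · rw [h.2.2.2, h.1]; tauto
        · rw [h.2.2.2, h.1]; tauto
        · tauto
      · ext b
        simp only [Set.mem_ofPred_eq, Set.mem_union]
        rcases hs b with h | h | h
        · rw [h.2.2.1, h.2.2.2, h.1]; tauto
        · rw [h.2.2.1, h.2.2.2, h.1]; tauto
        · rw [h.2.2]; tauto

theorem tileConn_preimage {n : ℕ} {ℓ : β → Fin (n + 1)}
    (hℓ : ∀ i : Fin n, Tileable X {b | ℓ b = i.castSucc ∨ ℓ b = i.succ})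
    (D E : Fin (n + 1) → Prop) [DecidablePred D] [DecidablePred E]
    (hDE : ∑ i, (if D i then (-1) ^ (i : ℕ) else 0 : ℤ) =
      ∑ i, (if E i then (-1) ^ (i : ℕ) else 0 : ℤ)) :
    TileConn X {b | D (ℓ b)} {b | E (ℓ b)} := by
  have hcard : ∀ (D : Fin (n + 1) → Prop) [DecidablePred D],
      (Fintype.card {i // D i ↔ Even (i : ℕ)} : ℤ) =
      ∑ i, (if D i then (-1) ^ (i : ℕ) else 0 : ℤ) +
        ∑ i : Fin (n + 1), (if Even (i : ℕ) then 0 else 1) := by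
    intro D _
    rw [Fintype.card_subtype, Finset.card_filter, ← Finset.sum_add_distrib]
    push_cast
    refine Finset.sum_congr rfl fun i _ => ?_
    rcases Nat.even_or_odd (i : ℕ) with hi | hi
    · simp [hi]
    · by_cases hD : D i <;> simp [Nat.not_even_iff_odd.2 hi, hD, hi.neg_one_pow]
  have hc : Fintype.card {i // D i ↔ Even (i : ℕ)} = Fintype.card {i // E i ↔ Even (i : ℕ)} := by
    zify
    rw [hcard, hcard, hDE]
  have e := (Fintype.equivOfCardEq hc).symm
  convert tileConn_comp_perm hℓ e.extendSubtype fun i => D i ↔ Even (i : ℕ) using 1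
  · ext b
    simp only [Set.mem_ofPred_eq]
    tauto
  · ext b
    have h : (D (e.extendSubtype (ℓ b)) ↔ Even (e.extendSubtype (ℓ b) : ℕ)) ↔
        (E (ℓ b) ↔ Even (ℓ b : ℕ)) := by
      by_cases hb : E (ℓ b) ↔ Even (ℓ b : ℕ)
      · exact iff_of_true (e.extendSubtype_mem _ hb) hb
      · exact iff_of_false (e.extendSubtype_not_mem _ hb) hb
    simp only [Set.mem_ofPred_eq]
    rw [h]
    tauto

theorem exists_path {T₁ T₂ : Set U} (h₁ : Tileable X T₁) (h₂ : Tileable X T₂)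
    (h : T₁ ∪ T₂ = Set.univ) (j : ℕ) :
    ∃ (β : Type) (_ : CubeLike β) (ℓ : β → Fin (2 * j + 1)),
      ∀ D : Fin (2 * j + 1) → Prop, ∀ _ : DecidablePred D,
        ∑ i, (if D i then (-1) ^ (i : ℕ) else 0 : ℤ) = 1 →
        TileConn X {b | D (ℓ b)} Set.univ := by
  obtain ⟨β, _, ℓ, hℓ, ht⟩ := exists_path_map h₁ h₂ h j
  refine ⟨β, inferInstance, fun b => ⟨ℓ b, hℓ b⟩, fun D _ hD => ?_⟩
  have ht' : ∀ i : Fin (2 * j), Tileable X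
      {b | (⟨ℓ b, hℓ b⟩ : Fin (2 * j + 1)) = i.castSucc ∨ (⟨ℓ b, hℓ b⟩ : Fin _) = i.succ} :=
    fun i => (ht i (by omega)).congr fun b => by simp [Fin.ext_iff]
  have hu : ∑ i : Fin (2 * j + 1), (if True then (-1) ^ (i : ℕ) else 0 : ℤ) = 1 := by
    simp only [if_true]
    rw [← Finset.sum_range fun i => (-1 : ℤ) ^ i]
    simp [neg_one_geom_sum]
  simpa using tileConn_preimage ht' D (fun _ => True) (hD.trans hu.symm)

end Path

section Span

variable {k : ℕ} (X : Set (Fin k → ZMod 2))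
variable {α β γ U J : Type} [CubeLike α] [CubeLike β] [CubeLike γ] [CubeLike U]

/-- The group of functions spanned by the indicators of tileable sets. -/
def tileSpan (α : Type) [CubeLike α] : AddSubgroup (α → ℤ) :=
  AddSubgroup.closure {f | ∃ T : Set α, Tileable X T ∧ f = T.indicator 1}

variable {X}

open scoped Classical in
theorem exists_signed_family {f : α → ℤ} (hf : f ∈ tileSpan X α) :
    ∃ (n : ℕ) (T : Fin n → Set α) (ε : Fin n → ℕ), (∀ m, Tileable X (T m)) ∧ (∀ m, ε m < 2) ∧
      ∀ a, ∑ m, (if a ∈ T m then (-1) ^ ε m else 0 : ℤ) = f a := by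
  rw [tileSpan, ← AddSubgroup.mem_toAddSubmonoid, AddSubgroup.closure_toAddSubmonoid] at hf
  obtain ⟨l, hl, rfl⟩ := AddSubmonoid.exists_list_of_mem_closure hf
  have key : ∀ m : Fin l.length, ∃ (T : Set α) (ε : ℕ), Tileable X T ∧ ε < 2 ∧
      ∀ a, (if a ∈ T then (-1) ^ ε else 0 : ℤ) = l[m] a := by
    intro m
    rcases hl _ (l.getElem_mem m.2) with ⟨T, hT, h⟩ | ⟨T, hT, h⟩
    · refine ⟨T, 0, hT, by omega, fun a => ?_⟩
      simp [h, Set.indicator_apply]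
    · refine ⟨T, 1, hT, by omega, fun a => ?_⟩
      rw [Fin.getElem_fin, ← neg_neg (l[(m : ℕ)]), h]
      by_cases ha : a ∈ T <;> simp [ha]
  choose T ε hT hε h using key
  refine ⟨_, T, ε, hT, hε, fun a => ?_⟩
  simp only [h]
  rw [← Fin.sum_univ_getElem l, Finset.sum_apply]
  rfl

theorem exists_tileConn_univ_of_mem_tileSpan {T₁ T₂ : Set U} (h₁ : Tileable X T₁)
    (h₂ : Tileable X T₂) (h : T₁ ∪ T₂ = Set.univ) (hf : (1 : α → ℤ) ∈ tileSpan X α) :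
    ∃ (β : Type) (_ : CubeLike β), TileConn X (∅ : Set (α × β)) Set.univ := by
  classical
  obtain ⟨n, T, ε, hT, hε, hsum⟩ := exists_signed_family hf
  obtain ⟨β, _, ℓ, hℓ⟩ := exists_path h₁ h₂ h n
  let v : Fin n → Fin (2 * n + 1) := fun m => ⟨2 * m + ε m, by have := hε m; omega⟩
  have hv : Function.Injective v := fun m m' hm => by
    have := hε m
    have := hε m'
    simp only [v, Fin.mk.injEq] at hm
    omega
  refine ⟨β, inferInstance, ?_⟩
  have hE : Tileable X (⋃ m, {z : α × β | z.1 ∈ T m ∧ ℓ z.2 = v m}) := by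
    refine .iUnion (fun m => .of_left fun b => (hT m).sep (ℓ b = v m)) fun m m' hm => ?_
    simp only [Set.disjoint_left]
    rintro z ⟨-, hz⟩ ⟨-, hz'⟩
    exact hm (hv (hz.symm.trans hz'))
  refine hE.conn_empty.trans ?_
  have key : ∀ a, TileConn X {b | ∃ m, a ∈ T m ∧ ℓ b = v m} Set.univ := by
    intro a
    refine hℓ (fun i => ∃ m, a ∈ T m ∧ i = v m) (fun i => Classical.propDecidable _) ?_
    refine Eq.trans ?_ (hsum a)
    have hv' : ∀ m, (∃ m', a ∈ T m' ∧ v m = v m') ↔ a ∈ T m := fun m =>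
      ⟨fun ⟨m', hm', h⟩ => hv h ▸ hm', fun hm => ⟨m, hm, rfl⟩⟩
    refine (Finset.sum_of_injOn v hv.injOn (by simp) ?_ ?_).symm
    · intro i _ hi
      refine if_neg ?_
      rintro ⟨m, -, rfl⟩
      exact hi ⟨m, by simp, rfl⟩
    · intro m _
      simp only [hv']
      simp [v, pow_add]
  convert TileConn.of_slices key using 1
  · ext; simp
  · simp

theorem indicator_mem_tileSpan {T : Set α} (hT : Tileable X T) :
    T.indicator 1 ∈ tileSpan X α := AddSubgroup.subset_closure ⟨T, hT, rfl⟩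

theorem mem_tileSpan_of_fibers [Finite J] (e : J × α ≃ γ)
    (he : ∀ j x y, cdist (e (j, x)) (e (j, y)) = cdist x y) {f : γ → ℤ}
    (h : ∀ j, (fun x => f (e (j, x))) ∈ tileSpan X α) : f ∈ tileSpan X γ := by
  classical
  have := Fintype.ofFinite J
  let E : J → (α → ℤ) →+ (γ → ℤ) := fun j =>
    { toFun := fun g z => if (e.symm z).1 = j then g (e.symm z).2 else 0
      map_zero' := by ext; simp
      map_add' := fun g g' => by ext z; by_cases hz : (e.symm z).1 = j <;> simp [hz] }
  have hE : ∀ j, ∀ g ∈ tileSpan X α, E j g ∈ tileSpan X γ := by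
    intro j
    change tileSpan X α ≤ (tileSpan X γ).comap (E j)
    refine (AddSubgroup.closure_le _).2 ?_
    rintro _ ⟨T, hT, rfl⟩
    have hT' : Tileable X {z | (e.symm z).2 ∈ T ∧ (e.symm z).1 = j} :=
      .of_fibers e he fun i => (hT.sep (i = j)).congr fun x => by simp
    have hET : E j (T.indicator 1) = Set.indicator {z | (e.symm z).2 ∈ T ∧ (e.symm z).1 = j} 1 := by
      ext z
      by_cases h1 : (e.symm z).2 ∈ T <;> by_cases h2 : (e.symm z).1 = j <;> simp [E, h1, h2]
    change E j _ ∈ tileSpan X γ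
    exact hET ▸ indicator_mem_tileSpan hT'
  have hf : f = ∑ j, E j fun x => f (e (j, x)) := by
    ext z
    simp [E, Finset.sum_apply]
  rw [hf]
  exact sum_mem fun j _ => hE j _ (h j)

theorem mem_tileSpan_of_left {f : α × β → ℤ} (h : ∀ b, (fun a => f (a, b)) ∈ tileSpan X α) :
    f ∈ tileSpan X (α × β) :=
  have := CubeLike.finite β
  mem_tileSpan_of_fibers (Equiv.prodComm _ _) (fun j x y => by simp [cdist_prod, cdist_self]) h

theorem mem_tileSpan_of_right {f : α × β → ℤ} (h : ∀ a, (fun b => f (a, b)) ∈ tileSpan X β) :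
    f ∈ tileSpan X (α × β) :=
  have := CubeLike.finite α
  mem_tileSpan_of_fibers (Equiv.refl _) (fun j x y => by simp [cdist_prod, cdist_self]) h

end Span

section Ring

variable {R : Type*} [CommRing R]

theorem Ideal.prod_one_add_mem {C : Type*} [Fintype C] {t : ℕ} (hC : Fintype.card C = t + 1)
    {x : C → R} (hx : ∀ c, x c ^ 2 = 1) {I : Ideal R} (hI : (2 : R) ^ t ∈ I)
    (h : ∀ c d, x c - x d ∈ I) : ∏ c, (1 + x c) ∈ I := by
  have : Nonempty C := Fintype.card_pos_iff.1 (by omega)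
  obtain ⟨d⟩ := this
  have hpow : ∀ n : ℕ, (1 + x d) ^ (n + 1) = 2 ^ n * (1 + x d) := by
    intro n
    induction n with
    | zero => simp
    | succ n ih => rw [pow_succ, ih]; linear_combination 2 ^ n * hx d
  rw [← Ideal.Quotient.eq_zero_iff_mem, map_prod]
  have hq : ∀ c, Ideal.Quotient.mk I (1 + x c) = Ideal.Quotient.mk I (1 + x d) := fun c =>
    Ideal.Quotient.eq.2 (by simpa using h c d)
  simp only [hq]
  rw [Finset.prod_const, Finset.card_univ, hC, ← map_pow, hpow, Ideal.Quotient.eq_zero_iff_mem]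
  exact I.mul_mem_right _ hI

theorem Ideal.mul_prod_one_add_mem {C : Type*} [Fintype C] {t : ℕ}
    (hC : Fintype.card C = t + 1) {J : Ideal R} (hJ : (2 : R) ^ t ∈ J) {k : ℕ}
    (x : Fin k → C → R) (hx : ∀ j c, x j c ^ 2 = 1) (g : (Fin k → ZMod 2) → R)
    (h : ∀ c : Fin k → C, ∑ v, g v * ∏ j, x j (c j) ^ (v j).val ∈ J) (v : Fin k → ZMod 2) :
    g v * ∏ j, ∏ c, (1 + x j c) ∈ J := by
  induction k with
  | zero =>
    have := h finZeroElim
    rw [Fintype.sum_subsingleton _ v] at this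
    simpa using this
  | succ k ih =>
    let G : ZMod 2 → (Fin k → C) → R := fun a c =>
      ∑ w : Fin k → ZMod 2, g (Fin.cons a w) * ∏ j : Fin k, x j.succ (c j) ^ (w j).val
    have hG : ∀ c₀ c, G 0 c + x 0 c₀ * G 1 c ∈ J := by
      intro c₀ c
      have hcons : ∀ (a : ZMod 2) (w : Fin k → ZMod 2),
          g (Fin.cons a w) * ∏ j, x j ((Fin.cons c₀ c : Fin (k + 1) → C) j) ^
            ((Fin.cons a w : Fin (k + 1) → ZMod 2) j).val =
          x 0 c₀ ^ a.val * (g (Fin.cons a w) * ∏ j : Fin k, x j.succ (c j) ^ (w j).val) := by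
        intro a w
        rw [Fin.prod_univ_succ]
        simp only [Fin.cons_zero, Fin.cons_succ]
        ring
      have hsum : ∑ v, g v * ∏ j, x j ((Fin.cons c₀ c : Fin (k + 1) → C) j) ^ (v j).val =
          ∑ a : ZMod 2, x 0 c₀ ^ a.val * G a c := by
        rw [← (Fin.consEquiv fun _ => ZMod 2).sum_comp, Fintype.sum_prod_type]
        refine Finset.sum_congr rfl fun a _ => ?_
        rw [Finset.mul_sum]
        exact Finset.sum_congr rfl fun w _ => hcons a w
      have h2 : ∑ a : ZMod 2, x 0 c₀ ^ a.val * G a c = G 0 c + x 0 c₀ * G 1 c := by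
        refine (Fin.sum_univ_two (M := R) fun a => x 0 c₀ ^ (ZMod.val (n := 2) a) * G a c).trans ?_
        change x 0 c₀ ^ 0 * G 0 c + x 0 c₀ ^ 1 * G 1 c = _
        ring
      rw [← h2, ← hsum]
      exact h _
    have key : ∀ a c, G a c * ∏ c₀, (1 + x 0 c₀) ∈ J := by
      intro a c
      have := Ideal.prod_one_add_mem hC (hx 0)
        (I := Submodule.comap (LinearMap.toSpanSingleton R R (G a c)) J)
        (by simpa using J.mul_mem_right _ hJ) fun d e => by
          have h1 := hG d c
          have h2 := hG e c
          simp only [Submodule.mem_comap, LinearMap.toSpanSingleton_apply, smul_eq_mul]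
          have ha : a = 0 ∨ a = 1 := by revert a; decide
          rcases ha with rfl | rfl
          · convert J.sub_mem (J.mul_mem_left (x 0 d) h2) (J.mul_mem_left (x 0 e) h1) using 1
            ring
          · convert J.sub_mem h1 h2 using 1
            ring
      simpa [mul_comm] using this
    have := ih (fun j => x j.succ) (fun j => hx j.succ)
      (fun w => g (Fin.cons (v 0) w) * ∏ c₀, (1 + x 0 c₀)) (fun c => ?_) (Fin.tail v)
    · simpa [Fin.prod_univ_succ, mul_assoc] using this
    · convert key (v 0) c using 1
      simp only [G, Finset.sum_mul]
      exact Finset.sum_congr rfl fun w _ => by ring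

end Ring

section Algebra

variable {k : ℕ} {X : Set (Fin k → ZMod 2)} {ι : Type} [Fintype ι]

theorem cdist_add_left (g x y : ι → ZMod 2) : cdist (g + x) (g + y) = cdist x y := by
  simp [cdist_pi, hammingDist]

variable (X) (ι) in
/-- The ideal of the group algebra of the cube whose coefficient functions lie in the span of the
indicators of tileable sets. -/
noncomputable def tileIdeal : Ideal (AddMonoidAlgebra ℤ (ι → ZMod 2)) where
  carrier := {r | (fun m => r.coeff m) ∈ tileSpan X (ι → ZMod 2)}
  zero_mem' := (tileSpan X (ι → ZMod 2)).zero_mem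
  add_mem' := fun ha hb => (tileSpan X (ι → ZMod 2)).add_mem ha hb
  smul_mem' := by
    intro r f hf
    induction r using AddMonoidAlgebra.induction_on with
    | add x y hx hy =>
      rw [add_smul]
      exact (tileSpan X (ι → ZMod 2)).add_mem hx hy
    | smul n x hx =>
      rw [smul_assoc]
      exact (tileSpan X (ι → ZMod 2)).zsmul_mem hx n
    | of g =>
      let E : ((ι → ZMod 2) → ℤ) →+ ((ι → ZMod 2) → ℤ) :=
        { toFun := fun f m => f (-g + m)
          map_zero' := rfl
          map_add' := fun _ _ => rfl }
      have hE : tileSpan X (ι → ZMod 2) ≤ (tileSpan X (ι → ZMod 2)).comap E := by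
        refine (AddSubgroup.closure_le _).2 ?_
        rintro _ ⟨T, hT, rfl⟩
        have hET : E (T.indicator 1) = Set.indicator ((g + ·) '' T) 1 := by
          ext m
          simp only [E, Set.image_add_left]
          rfl
        change E _ ∈ tileSpan X (ι → ZMod 2)
        exact hET ▸ indicator_mem_tileSpan (hT.image (cdist_add_left g))
      have := hE hf
      change E _ ∈ tileSpan X (ι → ZMod 2) at this
      have hEf : (E fun m => f.coeff m) = fun m =>
          (AddMonoidAlgebra.of ℤ (ι → ZMod 2) (Multiplicative.ofAdd g) • f).coeff m := by
        ext m
        simp [E]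
      change (fun m => _) ∈ tileSpan X (ι → ZMod 2)
      exact hEf ▸ this

theorem mem_tileIdeal {r : AddMonoidAlgebra ℤ (ι → ZMod 2)} :
    r ∈ tileIdeal X ι ↔ (fun m => r.coeff m) ∈ tileSpan X (ι → ZMod 2) := Iff.rfl

theorem prod_one_add_single [DecidableEq ι] :
    ∏ i : ι, (1 + AddMonoidAlgebra.single (Pi.single i (1 : ZMod 2)) (1 : ℤ)) =
      ∑ m : ι → ZMod 2, AddMonoidAlgebra.single m 1 := by
  have h : ∀ i : ι, (1 + AddMonoidAlgebra.single (Pi.single i (1 : ZMod 2)) (1 : ℤ)) =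
      ∑ a : ZMod 2, AddMonoidAlgebra.single (Pi.single i a : ι → ZMod 2) (1 : ℤ) := by
    intro i
    refine Eq.trans ?_ (Fin.sum_univ_two (fun a : ZMod 2 =>
      AddMonoidAlgebra.single (Pi.single i a : ι → ZMod 2) (1 : ℤ))).symm
    congr 1
    change _ = AddMonoidAlgebra.single (Pi.single i (0 : ZMod 2) : ι → ZMod 2) (1 : ℤ)
    rw [Pi.single_zero]
    rfl
  simp only [h]
  rw [Finset.prod_univ_sum]
  simp [Finset.univ_sum_single]

/-- The embedding of a cube which sends the `j`-th coordinate to the coordinate `(j, c j)`. -/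
def cubeEmb {C : Type} [DecidableEq C] (c : Fin k → C) (v : Fin k → ZMod 2) :
    Fin k × C → ZMod 2 := fun i => if i.2 = c i.1 then v i.1 else 0

variable {C : Type} [DecidableEq C]

theorem sum_single_eq_cubeEmb (c : Fin k → C) (v : Fin k → ZMod 2) :
    ∑ j, (Pi.single (j, c j) (v j) : Fin k × C → ZMod 2) = cubeEmb c v := by
  ext ⟨j, d⟩
  rw [Finset.sum_apply, Finset.sum_eq_single j]
  · by_cases h : d = c j <;> simp [cubeEmb, h]
  · intro i _ hi
    simp [hi.symm]
  · simp

theorem hammingDist_cubeEmb [Fintype C] (c : Fin k → C) (v w : Fin k → ZMod 2) :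
    hammingDist (cubeEmb c v) (cubeEmb c w) = hammingDist v w := by
  have h : ∀ i : Fin k × C, cubeEmb c v i ≠ cubeEmb c w i ↔ i.2 = c i.1 ∧ v i.1 ≠ w i.1 := by
    intro i
    by_cases hi : i.2 = c i.1 <;> simp [cubeEmb, hi]
  simp only [hammingDist, h]
  symm
  refine Finset.card_nbij (fun j => (j, c j)) (fun j => by simp)
    (fun i _ j _ h => (Prod.ext_iff.1 h).1) ?_
  rintro ⟨j, d⟩ hj
  simp only [Finset.coe_filter, Finset.mem_univ, true_and, Set.mem_ofPred_eq] at hj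
  obtain ⟨rfl, hj⟩ := hj
  exact ⟨j, by simpa using hj, rfl⟩

open scoped Classical in
theorem sum_cubeEmb_mem_tileIdeal [Fintype C] (c : Fin k → C) :
    ∑ v : Fin k → ZMod 2, (if v ∈ X then (1 : AddMonoidAlgebra ℤ (Fin k × C → ZMod 2)) else 0) *
      ∏ j, AddMonoidAlgebra.single (Pi.single (j, c j) 1) 1 ^ (v j).val ∈ tileIdeal X (Fin k × C) := by
  have hcopy : IsCopy X (cubeEmb c '' X) := ⟨_, fun v _ w _ => hammingDist_cubeEmb c v w, rfl⟩
  have hinj : Function.Injective (cubeEmb c : (Fin k → ZMod 2) → _) := fun v w h => by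
    rw [← hammingDist_eq_zero, ← hammingDist_cubeEmb c, h, hammingDist_self]
  have hprod : ∀ v : Fin k → ZMod 2,
      ∏ j, (AddMonoidAlgebra.single (Pi.single (j, c j) 1) 1 :
        AddMonoidAlgebra ℤ (Fin k × C → ZMod 2)) ^ (v j).val =
      AddMonoidAlgebra.single (cubeEmb c v) 1 := by
    intro v
    simp [← sum_single_eq_cubeEmb, ← Pi.single_smul]
  rw [mem_tileIdeal]
  convert indicator_mem_tileSpan hcopy.tileable using 1
  ext m
  simp only [hprod, ite_mul, one_mul, zero_mul, AddMonoidAlgebra.coeff_sum]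
  by_cases hm : m ∈ cubeEmb c '' X
  · obtain ⟨v, hv, rfl⟩ := hm
    rw [Finsupp.finsetSum_apply, Finset.sum_eq_single v]
    · rw [Set.indicator_of_mem (Set.mem_image_of_mem _ hv)]
      simp [hv]
    · intro w _ hw
      split_ifs
      · simp [hinj.eq_iff, hw]
      · simp
    · simp
  · rw [Set.indicator_of_notMem hm, Finsupp.finsetSum_apply]
    refine Finset.sum_eq_zero fun w _ => ?_
    split_ifs with hw
    · exact Finsupp.single_eq_of_ne fun h => hm ⟨w, hw, h.symm⟩
    · simp

theorem exists_one_sub_mem_tileSpan (hX : X.Nonempty) (t : ℕ) :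
    ∃ h : (Fin k × Fin (t + 1) → ZMod 2) → ℤ,
      1 - (2 : ℤ) ^ t • h ∈ tileSpan X (Fin k × Fin (t + 1) → ZMod 2) := by
  classical
  obtain ⟨v, hv⟩ := hX
  let J := tileIdeal X (Fin k × Fin (t + 1)) ⊔ Ideal.span {2 ^ t}
  have key := Ideal.mul_prod_one_add_mem (R := AddMonoidAlgebra ℤ (Fin k × Fin (t + 1) → ZMod 2))
    (C := Fin (t + 1)) (t := t) (by simp) (J := J)
    (Ideal.mem_sup_right (Ideal.mem_span_singleton_self _))
    (fun j c => AddMonoidAlgebra.single (Pi.single (j, c) 1) 1)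
    (fun j c => by
      simp only [AddMonoidAlgebra.single_pow, one_pow, ← Pi.single_smul]
      rw [show 2 • (1 : ZMod 2) = 0 from rfl, Pi.single_zero]
      rfl)
    (fun v => if v ∈ X then 1 else 0)
    (fun c => Ideal.mem_sup_left (sum_cubeEmb_mem_tileIdeal c)) v
  rw [if_pos hv, one_mul, ← Fintype.prod_prod_type'] at key
  simp only [Prod.mk.eta, prod_one_add_single] at key
  obtain ⟨y, hy, z, hz, hyz⟩ := Submodule.mem_sup.1 key
  obtain ⟨a, rfl⟩ := Ideal.mem_span_singleton.1 hz
  refine ⟨fun m => a.coeff m, ?_⟩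
  convert mem_tileIdeal.1 hy using 1
  rw [← eq_sub_iff_add_eq] at hyz
  have h2 : (2 : AddMonoidAlgebra ℤ (Fin k × Fin (t + 1) → ZMod 2)) ^ t * a = (2 : ℤ) ^ t • a := by
    rw [zsmul_eq_mul]; push_cast; rfl
  ext m
  rw [hyz, h2]
  simp [AddMonoidAlgebra.coeff_sum, Finsupp.single_apply, -zsmul_eq_mul]

theorem const_card_mem_tileSpan : (fun _ => (X.ncard : ℤ)) ∈ tileSpan X (Fin k → ZMod 2) := by
  classical
  have : (fun _ => (X.ncard : ℤ)) =
      ∑ g : Fin k → ZMod 2, Set.indicator ((g + ·) '' X) (1 : (Fin k → ZMod 2) → ℤ) := by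
    ext m
    simp only [Finset.sum_apply, Set.indicator_apply, Pi.one_apply]
    rw [Finset.sum_boole, Set.ncard_eq_toFinset_card']
    congr 1
    refine Finset.card_nbij' (m - ·) (m - ·) ?_ ?_ ?_ ?_ <;> intro x <;>
      simp [sub_eq_add_neg, add_comm]
  rw [this]
  exact sum_mem fun g _ => indicator_mem_tileSpan
    (IsCopy.tileable ⟨_, fun x _ y _ => cdist_add_left g x y, rfl⟩)

theorem one_mem_tileSpan (hX : X.Nonempty) {t : ℕ} (ht : X.ncard = 2 ^ t) :
    (1 : (Fin k × Fin (t + 1) → ZMod 2) × (Fin k → ZMod 2) → ℤ) ∈ tileSpan X _ := by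
  obtain ⟨h, hh⟩ := exists_one_sub_mem_tileSpan hX t
  have hc := const_card_mem_tileSpan (X := X)
  rw [ht] at hc
  have h1 : (fun z : (Fin k × Fin (t + 1) → ZMod 2) × (Fin k → ZMod 2) => 1 - 2 ^ t * h z.1) ∈
      tileSpan X _ := mem_tileSpan_of_left fun _ => hh
  have h2 : (fun z : (Fin k × Fin (t + 1) → ZMod 2) × (Fin k → ZMod 2) => 2 ^ t * h z.1) ∈
      tileSpan X _ := mem_tileSpan_of_right fun a => by
    convert zsmul_mem hc (h a) using 1
    ext
    simp [mul_comm]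
  convert add_mem h1 h2 using 1
  ext
  simp

end Algebra

theorem Tileable.pi_of_univ {k n : ℕ} {X : Set (Fin k → ZMod 2)} {α : Type} [CubeLike α]
    (h : Tileable X (Set.univ : Set α)) (hn : Fintype.card (Coord α) = n) :
    Tileable X (Set.univ : Set (Fin n → ZMod 2)) := by
  let e : Coord α ≃ Fin n := Fintype.equivFinOfCardEq hn
  let f : α ≃ (Fin n → ZMod 2) := toCube.trans (e.arrowCongr (Equiv.refl _))
  have hf : ∀ x y, cdist (f x) (f y) = cdist x y := by
    intro x y
    rw [cdist_pi]
    simp only [cdist, hammingDist]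
    refine Finset.card_nbij e.symm (fun i => by simp [f]) e.symm.injective.injOn fun i hi => ?_
    exact ⟨e i, by simpa [f] using hi, by simp⟩
  simpa [f.surjective.range_eq] using h.image hf

theorem Tileable.exists_forall_ge_pi {k : ℕ} {X : Set (Fin k → ZMod 2)} {α : Type} [CubeLike α]
    (h : Tileable X (Set.univ : Set α)) :
    ∃ n₀ : ℕ, ∀ n, n₀ ≤ n → Tileable X (Set.univ : Set (Fin n → ZMod 2)) := by
  refine ⟨Fintype.card (Coord α), fun n hn => ?_⟩
  obtain ⟨m, rfl⟩ := Nat.exists_eq_add_of_le hn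
  have hm : Tileable X (Set.univ : Set (α × (Fin m → ZMod 2))) := .of_left fun _ => h
  refine hm.pi_of_univ ?_
  refine (Fintype.card_sum (α := Coord α) (β := Fin m)).trans ?_
  rw [Fintype.card_fin]

theorem cube_adj {n : ℕ} {u v : Fin n → ZMod 2} : (cube n).Adj u v ↔ hammingDist u v = 1 := by
  have hs : ∀ i, (u i ≠ v i ∧ ∀ j, j ≠ i → u j = v j) ↔
      (Finset.univ.filter fun j => u j ≠ v j) = {i} := by
    intro i
    simp only [Finset.ext_iff, Finset.mem_filter, Finset.mem_univ, true_and, Finset.mem_singleton]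
    constructor
    · rintro ⟨h, h'⟩ j
      exact ⟨fun hj => by_contra fun hji => hj (h' j hji), by rintro rfl; exact h⟩
    · intro h
      exact ⟨(h i).2 rfl, fun j hj => by_contra fun hne => hj ((h j).1 hne)⟩
  rw [hammingDist, Finset.card_eq_one]
  simp only [← hs, cube, SimpleGraph.fromRel_adj]
  constructor
  · rintro ⟨-, ⟨i, hi, h⟩ | ⟨i, hi, h⟩⟩
    exacts [⟨i, hi, h⟩, ⟨i, hi.symm, fun j hj => (h j hj).symm⟩]
  · rintro ⟨i, hi, h⟩
    exact ⟨fun huv => hi (congrFun huv i), .inl ⟨i, hi, h⟩⟩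

theorem IsCopy.nonempty_iso {k n : ℕ} {H : (cube k).Subgraph} (hind : H.IsInduced)
    {B : Set (Fin n → ZMod 2)} (hB : IsCopy H.verts B) :
    Nonempty (H.coe ≃g ((⊤ : (cube n).Subgraph).induce B).coe) := by
  obtain ⟨f, hf, rfl⟩ := hB
  have hinj : Set.InjOn f H.verts := fun x hx y hy h => by
    rw [← hammingDist_eq_zero, ← hf x hx y hy, h, cdist_self]
  refine ⟨⟨Equiv.Set.imageOfInjOn f H.verts hinj, ?_⟩⟩
  rintro ⟨x, hx⟩ ⟨y, hy⟩
  have hH : H.Adj x y ↔ (cube k).Adj x y := ⟨fun h => h.adj_sub, hind hx hy⟩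
  have hxy := hf x hx y hy
  rw [cdist_pi] at hxy
  have hfx : f x ∈ f '' H.verts := Set.mem_image_of_mem f hx
  have hfy : f y ∈ f '' H.verts := Set.mem_image_of_mem f hy
  change (f x ∈ f '' H.verts ∧ f y ∈ f '' H.verts ∧ (cube n).Adj (f x) (f y)) ↔ H.Adj x y
  simp only [hH, cube_adj, hxy, hfx, hfy, true_and]

theorem Tileable.hasPerfectInducedPacking {k n : ℕ} {H : (cube k).Subgraph} (hind : H.IsInduced)
    (h : Tileable H.verts (Set.univ : Set (Fin n → ZMod 2))) :
    HasPerfectInducedPacking (cube n) H.coe := by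
  obtain ⟨P, hP, hd, hU⟩ := h
  refine ⟨(fun B => (⊤ : (cube n).Subgraph).induce B) '' P, ?_, ?_, ?_⟩
  · rintro _ ⟨B, hB, rfl⟩
    refine ⟨fun u hu v hv huv => ?_, (hP B hB).nonempty_iso hind⟩
    exact ⟨hu, hv, huv⟩
  · rintro _ ⟨B, hB, rfl⟩ _ ⟨C, hC, rfl⟩ hne
    exact hd hB hC fun h : B = C => hne (by rw [h])
  · simpa [← Set.sUnion_eq_biUnion] using hU

theorem gruslys_hypercube_packing (k : ℕ) (hk : 1 ≤ k)
    (H : (cube k).Subgraph) (hind : H.IsInduced) (hne : H.verts.Nonempty)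
    (hpow : ∃ t : ℕ, H.verts.ncard = 2 ^ t) :
    ∃ n₀ : ℕ, ∀ n, n₀ ≤ n → HasPerfectInducedPacking (cube n) H.coe := by
  obtain ⟨t, ht⟩ := hpow
  obtain ⟨U, _, T₁, T₂, h₁, h₂, h⟩ := exists_two_cover (exists_isCopy_mem hne)
  obtain ⟨β, _, hβ⟩ := exists_tileConn_univ_of_mem_tileSpan h₁ h₂ h (one_mem_tileSpan hne ht)
  obtain ⟨γ, _, hγ⟩ := hβ.exists_tileable_univ h₁ h₂ h
  obtain ⟨n₀, hn₀⟩ := hγ.exists_forall_ge_pi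
  exact ⟨n₀, fun n hn => (hn₀ n hn).hasPerfectInducedPacking hind⟩
end

section
/- Let T be a nonempty finite subset of ℤ^k for some k ≥ 1, regarded as a subset of Euclidean space ℝ^k. Then there exists n₀ such that for every n ≥ n₀, the set ℤ^n ⊆ ℝ^n can be partitioned into subsets each of which is isometric to T, i.e., for each part S there is a bijection from T to S preserving Euclidean distances. -/
namespace LatticeTiling

open Function

/-- The squared Euclidean distance between integer points. -/
def sqDist {ι : Type*} [Fintype ι] (x y : ι → ℤ) : ℤ := ∑ i, (x i - y i) ^ 2

/-- `S` is the image of `T` under a map preserving distances between points of `T`. -/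
def IsCopy {k : ℕ} (T : Finset (Fin k → ℤ)) {ι : Type*} [Fintype ι] (S : Set (ι → ℤ)) : Prop :=
  ∃ f : (Fin k → ℤ) → (ι → ℤ), f '' T = S ∧
    ∀ x ∈ T, ∀ y ∈ T, sqDist (f x) (f y) = sqDist x y

/-- `A` can be partitioned into copies of `T`. -/
def Tileable {k : ℕ} (T : Finset (Fin k → ℤ)) {ι : Type*} [Fintype ι] (A : Set (ι → ℤ)) : Prop :=
  ∃ P : Set (Set (ι → ℤ)), ⋃₀ P = A ∧ P.PairwiseDisjoint id ∧ ∀ S ∈ P, IsCopy T S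

section Tileable

variable {k : ℕ} {T : Finset (Fin k → ℤ)} {ι κ : Type*} [Fintype ι] [Fintype κ]

lemma Tileable.iUnion {α : Type*} {A : α → Set (ι → ℤ)}
    (hA : ∀ a b x, x ∈ A a → x ∈ A b → a = b) (h : ∀ a, Tileable T (A a)) :
    Tileable T (⋃ a, A a) := by
  choose P hP hd hc using h
  refine ⟨⋃ a, P a, ?_, ?_, ?_⟩
  · rw [Set.sUnion_iUnion]
    exact Set.iUnion_congr hP
  · intro s hs t ht hst
    obtain ⟨a, ha⟩ := Set.mem_iUnion.1 hs
    obtain ⟨b, hb⟩ := Set.mem_iUnion.1 ht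
    refine Set.disjoint_left.2 fun x hxs hxt => ?_
    have hab : a = b := hA a b x (hP a ▸ ⟨s, ha, hxs⟩) (hP b ▸ ⟨t, hb, hxt⟩)
    subst hab
    exact Set.disjoint_left.1 (hd a ha hb hst) hxs hxt
  · intro S hS
    obtain ⟨a, ha⟩ := Set.mem_iUnion.1 hS
    exact hc a S ha

lemma sqDist_eq_zero {x y : ι → ℤ} : sqDist x y = 0 ↔ x = y := by
  unfold sqDist
  rw [Finset.sum_eq_zero_iff_of_nonneg fun i _ => sq_nonneg _]
  simp [sub_eq_zero, funext_iff]

lemma Tileable.image {e : (ι → ℤ) → (κ → ℤ)}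
    (he : ∀ x y, sqDist (e x) (e y) = sqDist x y) {A : Set (ι → ℤ)} (h : Tileable T A) :
    Tileable T (e '' A) := by
  have hinj : Injective e := fun x y hxy => by
    rw [← sqDist_eq_zero, ← he, hxy, sqDist_eq_zero]
  obtain ⟨P, hP, hd, hc⟩ := h
  refine ⟨(e '' ·) '' P, ?_, ?_, ?_⟩
  · rw [← hP, Set.sUnion_image, Set.sUnion_eq_biUnion, Set.image_iUnion₂]
  · rintro _ ⟨s, hs, rfl⟩ _ ⟨t, ht, rfl⟩ hst
    have hne : s ≠ t := fun h => hst (by rw [h])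
    exact (Set.disjoint_image_iff hinj).2 (hd hs ht hne)
  · rintro _ ⟨s, hs, rfl⟩
    obtain ⟨f, rfl, hf⟩ := hc s hs
    exact ⟨e ∘ f, Set.image_comp .., fun x hx y hy => by simp [he, hf x hx y hy]⟩

/-- A set is tileable as soon as its sections along a partition of the ambient lattice into
isometrically embedded lattices are. -/
lemma Tileable.of_sections {ζ : Type*} {e : ζ → (ι → ℤ) → (κ → ℤ)}
    (he : ∀ z x y, sqDist (e z x) (e z y) = sqDist x y)
    (hcov : ∀ w, ∃ z x, e z x = w)
    (hdisj : ∀ z z' x x', e z x = e z' x' → z = z') {A : Set (κ → ℤ)}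
    (h : ∀ z, Tileable T (e z ⁻¹' A)) : Tileable T A := by
  have : A = ⋃ z, e z '' (e z ⁻¹' A) := by
    ext w
    simp only [Set.mem_iUnion, Set.mem_image, Set.mem_preimage]
    constructor
    · intro hw
      obtain ⟨z, x, rfl⟩ := hcov w
      exact ⟨z, x, hw, rfl⟩
    · rintro ⟨z, x, hx, rfl⟩
      exact hx
  rw [this]
  refine Tileable.iUnion ?_ fun z => (h z).image (he z)
  rintro z z' w ⟨x, _, rfl⟩ ⟨x', _, hx'⟩
  exact hdisj _ _ _ _ hx'.symm

end Tileable

/-- A colouring of an integer lattice with finitely many colours. -/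
structure Model where
  /-- the coordinates of the lattice -/
  ι : Type
  /-- the colours -/
  U : Type
  [fintypeι : Fintype ι]
  [fintypeU : Fintype U]
  /-- the colouring -/
  π : (ι → ℤ) → U

attribute [instance] Model.fintypeι Model.fintypeU

/-- A set of colours is a tile if the set of points with these colours is tileable. -/
def Model.tile {k : ℕ} (T : Finset (Fin k → ℤ)) (M : Model) (A : Set M.U) : Prop :=
  Tileable T (M.π ⁻¹' A)

/-- The product colouring. -/
abbrev Model.prod (M N : Model) : Model where
  ι := M.ι ⊕ N.ι
  U := M.U × N.U
  π z := (M.π (z ∘ Sum.inl), N.π (z ∘ Sum.inr))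

open Classical in
/-- The power of a colouring. -/
noncomputable abbrev Model.pow (M : Model) (J : Type) [Fintype J] : Model where
  ι := J × M.ι
  U := J → M.U
  π z j := M.π fun i => z (j, i)

section Model

variable {k : ℕ} {T : Finset (Fin k → ℤ)} {M N : Model}

/-- A set is a tile if the fibres of some function on it are tiles. -/
lemma Model.tile_of_fiber {α : Type*} (φ : M.U → α) {A : Set M.U}
    (h : ∀ a, M.tile T {u | u ∈ A ∧ φ u = a}) : M.tile T A := by
  have : M.π ⁻¹' A = ⋃ a, M.π ⁻¹' {u | u ∈ A ∧ φ u = a} := by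
    ext; simp
  unfold Model.tile
  rw [this]
  refine Tileable.iUnion ?_ h
  rintro a b x ⟨_, rfl⟩ ⟨_, rfl⟩
  rfl

lemma Model.tile_empty : M.tile T ∅ :=
  ⟨∅, by simp, by simp, by simp⟩

lemma Model.tile_iUnion {α : Type*} {A : α → Set M.U}
    (hA : ∀ a b x, x ∈ A a → x ∈ A b → a = b) (h : ∀ a, M.tile T (A a)) :
    M.tile T (⋃ a, A a) := by
  unfold Model.tile
  rw [Set.preimage_iUnion]
  exact Tileable.iUnion (fun a b x ha hb => hA a b _ ha hb) h

lemma Model.tile_union {A B : Set M.U} (hA : M.tile T A) (hB : M.tile T B)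
    (h : ∀ x ∈ A, x ∉ B) : M.tile T (A ∪ B) := by
  rw [Set.union_eq_iUnion]
  refine Model.tile_iUnion ?_ (by rintro (_ | _) <;> assumption)
  rintro (_ | _) (_ | _) x hx hx' <;> simp_all

lemma Model.tile_pow {J : Type} [Fintype J] [DecidableEq J] (j : J) {A : Set (J → M.U)}
    (h : ∀ f : J → M.U, M.tile T {u | update f j u ∈ A}) : (M.pow J).tile T A := by
  refine Tileable.of_sections (ι := M.ι) (κ := J × M.ι) (ζ := {j' // j' ≠ j} × M.ι → ℤ)
    (e := fun z x p => if h : p.1 = j then x p.2 else z (⟨p.1, h⟩, p.2)) ?_ ?_ ?_ ?_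
  · intro z x y
    simp only [sqDist, Fintype.sum_prod_type]
    rw [Finset.sum_eq_single j]
    · simp
    · intro b _ hb
      simp [hb]
    · simp
  · intro w
    refine ⟨fun p => w (p.1, p.2), fun i => w (j, i), ?_⟩
    ext ⟨a, b⟩
    by_cases h : a = j
    · subst h; simp
    · simp [h]
  · intro z z' x x' hxx
    ext ⟨⟨a, ha⟩, b⟩
    simpa [ha] using congrFun hxx (a, b)
  · intro z
    have key : ∀ x : M.ι → ℤ,
        (M.pow J).π (fun p => if h : p.1 = j then x p.2 else z (⟨p.1, h⟩, p.2)) =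
          update ((M.pow J).π fun p => if h : p.1 = j then 0 else z (⟨p.1, h⟩, p.2)) j (M.π x) := by
      intro x
      funext j'
      by_cases hj : j' = j
      · subst hj; simp
      · simp [hj]
    have := h ((M.pow J).π fun p => if h : p.1 = j then 0 else z (⟨p.1, h⟩, p.2))
    unfold Model.tile at this
    convert this using 1
    ext x
    exact iff_of_eq (congrArg (· ∈ A) (key x))

lemma Model.tile_prod_left {A : Set (M.U × N.U)}
    (h : ∀ y : N.U, M.tile T {x | (x, y) ∈ A}) : (M.prod N).tile T A := by
  refine Tileable.of_sections (ι := M.ι) (κ := M.ι ⊕ N.ι) (ζ := N.ι → ℤ)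
    (e := fun z x => Sum.elim x z) ?_ ?_ ?_ ?_
  · intro z x y
    simp [sqDist]
  · exact fun w => ⟨w ∘ Sum.inr, w ∘ Sum.inl, Sum.elim_comp_inl_inr w⟩
  · intro z z' x x' hxx
    simpa using congrArg (· ∘ Sum.inr) hxx
  · exact fun z => h (N.π z)

lemma Model.tile_prod_right {A : Set (M.U × N.U)}
    (h : ∀ x : M.U, N.tile T {y | (x, y) ∈ A}) : (M.prod N).tile T A := by
  refine Tileable.of_sections (ι := N.ι) (κ := M.ι ⊕ N.ι) (ζ := M.ι → ℤ)
    (e := fun z x => Sum.elim z x) ?_ ?_ ?_ ?_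
  · intro z x y
    simp [sqDist]
  · exact fun w => ⟨w ∘ Sum.inl, w ∘ Sum.inr, Sum.elim_comp_inl_inr w⟩
  · intro z z' x x' hxx
    simpa using congrArg (· ∘ Sum.inl) hxx
  · exact fun z => h (M.π z)

end Model
section Powers

variable {k : ℕ} {T : Finset (Fin k → ℤ)} {M N : Model} {J : Type} [Fintype J] [DecidableEq J]

lemma Model.tile_pow_and {j : J} {B : Set (J → M.U)} {C : Set M.U}
    (hB : ∀ f u, update f j u ∈ B ↔ f ∈ B) (hC : M.tile T C) :
    (M.pow J).tile T {f | f ∈ B ∧ f j ∈ C} := by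
  refine Model.tile_pow j fun f => ?_
  by_cases hf : f ∈ B
  · simpa [hB, hf] using hC
  · simpa [hB, hf] using Model.tile_empty

lemma Model.tile_pow_exists (c : J → Set M.U) (hc : ∀ j, M.tile T (c j)) (K : Finset J)
    (B : Set (J → M.U)) (hB : ∀ j ∈ K, ∀ f u, update f j u ∈ B ↔ f ∈ B) :
    (M.pow J).tile T {f | f ∈ B ∧ ∃ j ∈ K, f j ∈ c j} := by
  induction K using Finset.induction_on generalizing B with
  | empty => simpa using Model.tile_empty
  | insert j K hj ih =>
    have h1 := Model.tile_pow_and (hB j (by simp)) (hc j)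
    have h2 := ih {f | f ∈ B ∧ f j ∉ c j} fun j' hj' f u => by
      have : j ≠ j' := fun h => hj (h ▸ hj')
      simp [hB j' (by simp [hj']), this]
    convert Model.tile_union h1 h2 ?_ using 1
    · ext f
      simp only [Finset.mem_insert, Set.mem_ofPred_eq, Set.mem_union, exists_eq_or_imp]
      tauto
    · rintro f ⟨_, hf⟩ ⟨⟨_, hf'⟩, _⟩
      exact hf' hf

/-- A partition into `L` linearly ordered cells such that the union of two consecutive cells is
always a tile. -/
structure IsPath (T : Finset (Fin k → ℤ)) (M : Model) (c : M.U → ℕ) (L : ℕ) : Prop where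
  lt : ∀ u, c u < L
  tile : ∀ m, m + 1 < L → M.tile T {u | c u = m ∨ c u = m + 1}

lemma IsPath.tile_interval {c : M.U → ℕ} {L : ℕ} (h : IsPath T M c L) {m m' : ℕ} (hm : m' ≤ L)
    (heven : Even (m' - m)) : M.tile T {u | m ≤ c u ∧ c u < m'} := by
  obtain ⟨n, hn⟩ := heven
  refine Model.tile_of_fiber (fun u => (c u - m) / 2) fun a => ?_
  by_cases ha : a < n
  · convert h.tile (m + 2 * a) (by omega) using 1
    ext u
    simp only [Set.mem_ofPred_eq]
    omega
  · convert Model.tile_empty using 1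
    ext u
    simp only [Set.mem_ofPred_eq, Set.mem_empty_iff_false, iff_false]
    omega

lemma IsPath.tile_ne {c : M.U → ℕ} {L : ℕ} (h : IsPath T M c L) (hL : Odd L) {a : ℕ}
    (ha : a < L) (heven : Even a) : M.tile T {u | c u ≠ a} := by
  have h1 := h.tile_interval (m := 0) ha.le (by simpa using heven)
  have h2 := h.tile_interval (m := a + 1) le_rfl (by rw [Nat.even_sub (by omega)]; grind)
  convert Model.tile_union h1 h2 ?_ using 1
  · ext u
    have := h.lt u
    simp only [Set.mem_ofPred_eq, Set.mem_union]
    omega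
  · intro u
    simp only [Set.mem_ofPred_eq]
    omega

/-- In the plane spanned by two coordinates, the complement of a cell with two odd coordinates is
a pinwheel of four boxes, each having a side of even length. -/
lemma IsPath.tile_pow_ne_or_ne {c : M.U → ℕ} {L : ℕ} (h : IsPath T M c L) (hL : Odd L)
    {j j' : J} (hj : j ≠ j') {B : Set (J → M.U)} (hB : ∀ f u, update f j u ∈ B ↔ f ∈ B)
    (hB' : ∀ f u, update f j' u ∈ B ↔ f ∈ B) {a a' : ℕ} (ha : a < L) (ha' : a' < L)
    (hodd : Odd a) (hodd' : Odd a') :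
    (M.pow J).tile T {f | f ∈ B ∧ (c (f j) ≠ a ∨ c (f j') ≠ a')} := by
  have h1 := Model.tile_pow_and (T := T) (j := j) (B := {f | f ∈ B ∧ c (f j') < a'})
    (by simp [hB, hj.symm])
    (h.tile_interval (m := 0) (m' := a + 1) (by omega) (by grind))
  have h2 := Model.tile_pow_and (T := T) (j := j') (B := {f | f ∈ B ∧ a < c (f j)})
    (by simp [hB', hj])
    (h.tile_interval (m := 0) (m' := a' + 1) (by omega) (by grind))
  have h3 := Model.tile_pow_and (T := T) (j := j) (B := {f | f ∈ B ∧ a' < c (f j')})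
    (by simp [hB, hj.symm])
    (h.tile_interval (m := a) (m' := L) le_rfl (by rw [Nat.even_sub ha.le]; grind))
  have h4 := Model.tile_pow_and (T := T) (j := j') (B := {f | f ∈ B ∧ c (f j) < a})
    (by simp [hB', hj])
    (h.tile_interval (m := a') (m' := L) le_rfl (by rw [Nat.even_sub ha'.le]; grind))
  convert Model.tile_union (Model.tile_union h1 h2 ?_) (Model.tile_union h3 h4 ?_) ?_ using 1
  · ext f
    have := h.lt (f j)
    have := h.lt (f j')
    simp only [Set.mem_ofPred_eq, Set.mem_union]
    by_cases hf : f ∈ B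
    · simp only [hf, true_and]
      omega
    · simp [hf]
  all_goals
    intro f
    simp only [Set.mem_ofPred_eq, Set.mem_union]
    omega

/-- Deleting a product of cells whose indices have an even sum leaves a tile. -/
lemma IsPath.tile_pow_exists_ne {c : M.U → ℕ} {L : ℕ} (h : IsPath T M c L) (hL : Odd L)
    {w : J → ℕ} (hw : ∀ j, w j < L) (K : Finset J) (heven : Even (∑ j ∈ K, w j))
    (B : Set (J → M.U)) (hB : ∀ j ∈ K, ∀ f u, update f j u ∈ B ↔ f ∈ B) :
    (M.pow J).tile T {f | f ∈ B ∧ ∃ j ∈ K, c (f j) ≠ w j} := by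
  induction K using Finset.strongInduction generalizing B with
  | H K ih =>
  by_cases hK : ∃ j ∈ K, Even (w j)
  · obtain ⟨j, hj, hje⟩ := hK
    have h1 := Model.tile_pow_and (hB j hj) (h.tile_ne hL (hw j) hje)
    have hs := Finset.add_sum_erase K w hj
    have h2 := ih (K.erase j) (Finset.erase_ssubset hj) (by grind)
      {f | f ∈ B ∧ c (f j) = w j} fun j' hj' f u => by
        simp [hB j' (Finset.mem_of_mem_erase hj'), (Finset.ne_of_mem_erase hj').symm]
    convert Model.tile_union h1 h2 ?_ using 1
    · ext f
      rw [← Finset.insert_erase hj]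
      simp only [Finset.mem_insert, Set.mem_ofPred_eq, Set.mem_union, exists_eq_or_imp]
      simp only [Finset.erase_insert_eq_erase, Finset.erase_idem]
      tauto
    · rintro f ⟨_, hf⟩ ⟨⟨_, hf'⟩, _⟩
      exact hf hf'
  push Not at hK
  obtain rfl | ⟨j, hj⟩ := K.eq_empty_or_nonempty
  · simpa using Model.tile_empty
  have hs := Finset.add_sum_erase K w hj
  obtain he | ⟨j', hj'⟩ := (K.erase j).eq_empty_or_nonempty
  · rw [he, Finset.sum_empty, add_zero] at hs
    exact absurd (hs ▸ heven) (hK j hj)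
  have hs' := Finset.add_sum_erase _ w hj'
  have hjK := Finset.mem_of_mem_erase hj'
  have hjj := Finset.ne_of_mem_erase hj'
  have o1 := Nat.not_even_iff_odd.1 (hK j hj)
  have o2 := Nat.not_even_iff_odd.1 (hK j' hjK)
  have h1 := h.tile_pow_ne_or_ne hL hjj.symm (hB j hj) (hB j' hjK) (hw j) (hw j') o1 o2
  have h2 := ih ((K.erase j).erase j')
    ((Finset.erase_ssubset hj').trans (Finset.erase_ssubset hj)) (by grind)
    {f | f ∈ B ∧ c (f j) = w j ∧ c (f j') = w j'} fun i hi f u => by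
      have h1 := Finset.ne_of_mem_erase hi
      have h2 := Finset.mem_of_mem_erase hi
      simp [hB i (Finset.mem_of_mem_erase h2), (Finset.ne_of_mem_erase h2).symm, h1.symm]
  convert Model.tile_union h1 h2 ?_ using 1
  · ext f
    have : (∃ i ∈ K, c (f i) ≠ w i) ↔ c (f j) ≠ w j ∨ c (f j') ≠ w j' ∨
        ∃ i ∈ (K.erase j).erase j', c (f i) ≠ w i := by
      constructor
      · rintro ⟨i, hi, hne⟩
        by_cases e1 : i = j
        · exact .inl (e1 ▸ hne)
        by_cases e2 : i = j'
        · exact .inr (.inl (e2 ▸ hne))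
        exact .inr (.inr ⟨i, by simp [e1, e2, hi], hne⟩)
      · rintro (h | h | ⟨i, hi, h⟩)
        · exact ⟨j, hj, h⟩
        · exact ⟨j', hjK, h⟩
        · exact ⟨i, Finset.mem_of_mem_erase (Finset.mem_of_mem_erase hi), h⟩
    simp only [Set.mem_ofPred_eq, Set.mem_union, this]
    tauto
  · rintro f ⟨_, hf⟩ ⟨⟨_, hf1, hf2⟩, _⟩
    exact hf.elim (· hf1) (· hf2)

lemma mul_add_inj {L a b x y : ℕ} (hx : x < L) (hy : y < L) :
    a * L + x = b * L + y ↔ a = b ∧ x = y := by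
  refine ⟨fun h => ?_, by rintro ⟨rfl, rfl⟩; rfl⟩
  have hL : 0 < L := by omega
  have h1 := congrArg (· / L) h
  have h2 := congrArg (· % L) h
  simp only [Nat.mul_add_mod_of_lt hx, Nat.mul_add_mod_of_lt hy] at h2
  simp only [Nat.add_div_of_dvd_right (Dvd.intro_left a rfl),
    Nat.add_div_of_dvd_right (Dvd.intro_left b rfl), Nat.mul_div_cancel _ hL, Nat.div_eq_of_lt hx,
    Nat.div_eq_of_lt hy, add_zero] at h1
  exact ⟨h1, h2⟩

/-- Traversing the grid of cells of a product boustrophedonically. -/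
lemma IsPath.prod {c : M.U → ℕ} {c' : N.U → ℕ} {L L' : ℕ} (h : IsPath T M c L)
    (h' : IsPath T N c' L') :
    IsPath T (M.prod N)
      (fun p => c' p.2 * L + if Even (c' p.2) then c p.1 else L - 1 - c p.1) (L' * L) := by
  have hlt : ∀ p : M.U × N.U, (if Even (c' p.2) then c p.1 else L - 1 - c p.1) < L := by
    intro p
    have := h.lt p.1
    split_ifs <;> omega
  constructor
  · intro p
    have h3 : (c' p.2 + 1) * L ≤ L' * L := Nat.mul_le_mul_right _ (h'.lt p.2)
    have := hlt p
    grind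
  intro m hm
  have hL : 0 < L := by
    by_contra! hL
    simp [Nat.le_zero.1 hL] at hm
  obtain ⟨q, r, hr, rfl⟩ : ∃ q r, r < L ∧ m = q * L + r :=
    ⟨m / L, m % L, Nat.mod_lt _ hL, (Nat.div_add_mod' m L).symm⟩
  obtain hr' | hr' := lt_or_ge (r + 1) L
  · refine Model.tile_prod_left fun y => ?_
    have key : ∀ x, (x, y) ∈ {p : M.U × N.U |
        (c' p.2 * L + if Even (c' p.2) then c p.1 else L - 1 - c p.1) = q * L + r ∨
        (c' p.2 * L + if Even (c' p.2) then c p.1 else L - 1 - c p.1) = q * L + r + 1} ↔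
        c' y = q ∧ ((if Even q then c x else L - 1 - c x) = r ∨
          (if Even q then c x else L - 1 - c x) = r + 1) := by
      intro x
      simp only [Set.mem_ofPred_eq, add_assoc, mul_add_inj (hlt (x, y)) hr,
        mul_add_inj (hlt (x, y)) hr', ← and_or_left]
      refine and_congr_right ?_
      rintro rfl
      rfl
    simp only [key]
    by_cases hy : c' y = q
    · by_cases hq : Even q
      · simpa [hy, hq] using h.tile r hr'
      · convert h.tile (L - 1 - r - 1) (by omega) using 1
        ext x
        have := h.lt x
        simp only [hy, hq, Set.mem_ofPred_eq, if_false, true_and]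
        omega
    · simpa [hy] using Model.tile_empty
  · obtain rfl : L = r + 1 := by omega
    have hq : q + 1 < L' := by
      by_contra! hq
      nlinarith [Nat.mul_le_mul_right (r + 1) hq]
    refine Model.tile_prod_right fun x => ?_
    have key : ∀ y, (x, y) ∈ {p : M.U × N.U |
        (c' p.2 * (r + 1) + if Even (c' p.2) then c p.1 else r + 1 - 1 - c p.1) =
          q * (r + 1) + r ∨
        (c' p.2 * (r + 1) + if Even (c' p.2) then c p.1 else r + 1 - 1 - c p.1) =
          q * (r + 1) + r + 1} ↔
        (c' y = q ∨ c' y = q + 1) ∧ c x = if Even q then r else 0 := by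
      intro y
      have hx := h.lt x
      have e : q * (r + 1) + r + 1 = (q + 1) * (r + 1) + 0 := by ring
      rw [Set.mem_ofPred_eq, e, mul_add_inj (hlt (x, y)) hr, mul_add_inj (hlt (x, y)) hL]
      have := hlt (x, y)
      by_cases hq : Even q
      · have hq' : ¬ Even (q + 1) := by grind
        constructor
        · rintro (⟨h1, h2⟩ | ⟨h1, h2⟩) <;> dsimp only at h1 h2 <;>
            simp only [h1, hq, hq', if_true, if_false, true_or, or_true, true_and] at h2 ⊢ <;>
            omega
        · rintro ⟨h1 | h1, h2⟩ <;> simp_all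
      · have hq' : Even (q + 1) := by grind
        constructor
        · rintro (⟨h1, h2⟩ | ⟨h1, h2⟩) <;> dsimp only at h1 h2 <;>
            simp only [h1, hq, hq', if_true, if_false, true_or, or_true, true_and] at h2 ⊢ <;>
            omega
        · rintro ⟨h1 | h1, h2⟩ <;> simp_all
    simp only [key]
    by_cases hx : c x = if Even q then r else 0
    · simpa [hx] using h'.tile q hq
    · simpa [hx] using Model.tile_empty

end Powers

section ShortPath

variable {k : ℕ} {T : Finset (Fin k → ℤ)} {M : Model}

/-- If every colour belongs to a tile, then the complements of two disjoint sets of colours of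
some model are tiles. -/
lemma exists_isPath_three (h : ∀ u, ∃ A, u ∈ A ∧ M.tile T A) :
    ∃ (N : Model) (c : N.U → ℕ), IsPath T N c 3 := by
  classical
  choose A hA htile using h
  let V := Fin (Fintype.card M.U) → M.U
  have : Nonempty M.U := ⟨M.π 0⟩
  have : Nonempty V := inferInstance
  have hK : ∀ x : (V → M.U) → M.U, ∃ e : Fin (Fintype.card M.U) → V,
      ∀ y, (∀ f : V → M.U, x f ∉ A (f y)) → ∃ j, e j = y := by
    intro x
    let K := {y : V // ∀ f : V → M.U, x f ∉ A (f y)}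
    obtain hc | hc := le_total (Fintype.card M.U) (Fintype.card K)
    · obtain ⟨g⟩ := Function.Embedding.nonempty_of_card_le hc
      let f : V → M.U := invFun fun u => (g u).1
      have hf : f (g (x f)).1 = x f :=
        leftInverse_invFun (Subtype.val_injective.comp g.injective) (x f)
      have hg := (g (x f)).2 f
      rw [hf] at hg
      exact absurd (hA _) hg
    · obtain ⟨g⟩ := Function.Embedding.nonempty_of_card_le
        (hc.trans (Fintype.card_fin _).ge)
      refine ⟨extend g Subtype.val fun _ => Classical.arbitrary V, fun y hy => ⟨g ⟨y, hy⟩, ?_⟩⟩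
      rw [g.injective.extend_apply]
  choose e he using hK
  let N := (M.pow (V → M.U)).prod (M.pow (Fin (Fintype.card M.U)))
  let R₁ : Set N.U := {p | ∃ f : V → M.U, p.1 f ∈ A (f p.2)}
  let R₂ : Set N.U := {p | ∃ j, p.2 j ∈ A (e p.1 j j)}
  have h₁ : N.tile T R₁ := Model.tile_prod_left fun y => by
    have := Model.tile_pow_exists (fun f : V → M.U => A (f y)) (fun _ => htile _) Finset.univ
      Set.univ (by simp)
    simp only [Finset.mem_univ, Set.mem_univ, true_and] at this
    exact this
  have h₂ : N.tile T R₂ := Model.tile_prod_right fun x => by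
    have := Model.tile_pow_exists (fun j => A (e x j j)) (fun _ => htile _) Finset.univ
      Set.univ (by simp)
    simp only [Finset.mem_univ, Set.mem_univ, true_and] at this
    exact this
  have h₁₂ : ∀ p : N.U, p ∈ R₁ ∨ p ∈ R₂ := by
    intro p
    by_contra! hp
    obtain ⟨j, hj⟩ := he p.1 p.2 fun f hf => hp.1 ⟨f, hf⟩
    exact hp.2 ⟨j, hj ▸ hA _⟩
  refine ⟨N, fun p => if p ∉ R₁ then 0 else if p ∉ R₂ then 2 else 1, ?_, ?_⟩
  · intro p
    split_ifs <;> simp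
  · intro m hm
    obtain rfl | rfl : m = 0 ∨ m = 1 := by omega
    · convert h₂ using 1
      ext p
      have := h₁₂ p
      simp only [Set.mem_ofPred_eq]
      split_ifs <;> simp_all
    · convert h₁ using 1
      ext p
      simp only [Set.mem_ofPred_eq]
      split_ifs <;> simp_all

lemma exists_isPath_three_pow (h : ∀ u, ∃ A, u ∈ A ∧ M.tile T A) (n : ℕ) :
    ∃ (N : Model) (c : N.U → ℕ), IsPath T N c (3 ^ n) := by
  induction n with
  | zero => exact ⟨M, fun _ => 0, by simp, by simp⟩
  | succ n ih =>
    obtain ⟨N, c, hc⟩ := ih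
    obtain ⟨N', c', hc'⟩ := exists_isPath_three h
    exact ⟨_, _, hc'.prod hc⟩

end ShortPath

section Covers

variable {k : ℕ} {T : Finset (Fin k → ℤ)} {M N : Model}

/-- The sums of indicator functions of tiles. -/
def Model.cov (T : Finset (Fin k → ℤ)) (M : Model) : AddSubmonoid (M.U → ℤ) :=
  AddSubmonoid.closure {g | ∃ A, M.tile T A ∧ g = A.indicator 1}

lemma Model.indicator_mem_cov {A : Set M.U} (h : M.tile T A) : A.indicator 1 ∈ M.cov T :=
  AddSubmonoid.subset_closure ⟨A, h, rfl⟩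

lemma Model.mem_cov_prod_left {g : M.U × N.U → ℤ} (h : ∀ y, (fun x => g (x, y)) ∈ M.cov T) :
    g ∈ (M.prod N).cov T := by
  classical
  let φ (y : N.U) : (M.U → ℤ) →+ (M.U × N.U → ℤ) :=
    { toFun := fun f p => if p.2 = y then f p.1 else 0
      map_zero' := by ext; simp
      map_add' := fun f f' => by ext p; simp only [Pi.add_apply]; split_ifs <;> simp }
  have hφ : ∀ y, M.cov T ≤ AddSubmonoid.comap (φ y) ((M.prod N).cov T) := by
    intro y
    refine AddSubmonoid.closure_le.2 ?_
    rintro _ ⟨A, hA, rfl⟩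
    have : φ y (A.indicator 1) = ({p | p.1 ∈ A ∧ p.2 = y} : Set (M.U × N.U)).indicator 1 := by
      ext p
      by_cases h1 : p.1 ∈ A <;> by_cases h2 : p.2 = y <;> simp [φ, h1, h2]
    change φ y _ ∈ (M.prod N).cov T
    rw [this]
    refine Model.indicator_mem_cov (Model.tile_prod_left fun y' => ?_)
    by_cases hy : y' = y
    · simpa [hy] using hA
    · simpa [hy] using Model.tile_empty
  have : g = ∑ y, φ y fun x => g (x, y) := by
    ext p
    simp [φ]
  rw [this]
  exact sum_mem fun y _ => hφ y (h y)

lemma Model.mem_cov_prod_right {g : M.U × N.U → ℤ} (h : ∀ x, (fun y => g (x, y)) ∈ N.cov T) :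
    g ∈ (M.prod N).cov T := by
  classical
  let φ (x : M.U) : (N.U → ℤ) →+ (M.U × N.U → ℤ) :=
    { toFun := fun f p => if p.1 = x then f p.2 else 0
      map_zero' := by ext; simp
      map_add' := fun f f' => by ext p; simp only [Pi.add_apply]; split_ifs <;> simp }
  have hφ : ∀ x, N.cov T ≤ AddSubmonoid.comap (φ x) ((M.prod N).cov T) := by
    intro x
    refine AddSubmonoid.closure_le.2 ?_
    rintro _ ⟨A, hA, rfl⟩
    have : φ x (A.indicator 1) = ({p | p.2 ∈ A ∧ p.1 = x} : Set (M.U × N.U)).indicator 1 := by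
      ext p
      by_cases h1 : p.2 ∈ A <;> by_cases h2 : p.1 = x <;> simp [φ, h1, h2]
    change φ x _ ∈ (M.prod N).cov T
    rw [this]
    refine Model.indicator_mem_cov (Model.tile_prod_right fun x' => ?_)
    by_cases hx : x' = x
    · simpa [hx] using hA
    · simpa [hx] using Model.tile_empty
  have : g = ∑ x, φ x fun y => g (x, y) := by
    ext p
    simp [φ]
  rw [this]
  exact sum_mem fun x _ => hφ x (h x)

/-- The functions which, together with their opposites, become sums of indicator functions of
tiles after adding a multiple of `r`. -/
def Model.bal (T : Finset (Fin k → ℤ)) (r : ℤ) (M : Model) : AddSubgroup (M.U → ℤ) where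
  carrier := {h | (∃ C : ℕ, h + C • const M.U r ∈ M.cov T) ∧
    ∃ C : ℕ, -h + C • const M.U r ∈ M.cov T}
  zero_mem' := ⟨⟨0, by simp⟩, ⟨0, by simp⟩⟩
  add_mem' := by
    rintro g h ⟨⟨C₁, h₁⟩, ⟨C₂, h₂⟩⟩ ⟨⟨C₃, h₃⟩, ⟨C₄, h₄⟩⟩
    refine ⟨⟨C₁ + C₃, ?_⟩, ⟨C₂ + C₄, ?_⟩⟩
    · convert add_mem h₁ h₃ using 1
      rw [add_smul]; abel
    · convert add_mem h₂ h₄ using 1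
      rw [add_smul]; abel
  neg_mem' := by
    rintro g ⟨h₁, h₂⟩
    exact ⟨h₂, by simpa using h₁⟩

lemma Model.mem_bal_prod_left {r : ℤ} (hr : const M.U r ∈ M.cov T) {h : M.U × N.U → ℤ}
    (hh : ∀ y, (fun x => h (x, y)) ∈ M.bal T r) : h ∈ (M.prod N).bal T r := by
  have aux : ∀ f : M.U × N.U → ℤ,
      (∀ y, ∃ C : ℕ, (fun x => f (x, y)) + C • const M.U r ∈ M.cov T) →
      ∃ C : ℕ, f + C • const (M.U × N.U) r ∈ (M.prod N).cov T := by
    intro f hf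
    choose C hC using hf
    refine ⟨∑ y, C y, Model.mem_cov_prod_left fun y => ?_⟩
    convert add_mem (hC y) (nsmul_mem hr (∑ y, C y - C y)) using 1
    have : C y ≤ ∑ y, C y := Finset.single_le_sum (fun _ _ => Nat.zero_le _) (Finset.mem_univ y)
    rw [add_assoc, ← add_smul, Nat.add_sub_cancel' this]
    rfl
  exact ⟨aux h fun y => (hh y).1, aux (-h) fun y => (hh y).2⟩

lemma Model.mem_bal_prod_right {r : ℤ} (hr : const N.U r ∈ N.cov T) {h : M.U × N.U → ℤ}
    (hh : ∀ x, (fun y => h (x, y)) ∈ N.bal T r) : h ∈ (M.prod N).bal T r := by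
  have aux : ∀ f : M.U × N.U → ℤ,
      (∀ x, ∃ C : ℕ, (fun y => f (x, y)) + C • const N.U r ∈ N.cov T) →
      ∃ C : ℕ, f + C • const (M.U × N.U) r ∈ (M.prod N).cov T := by
    intro f hf
    choose C hC using hf
    refine ⟨∑ x, C x, Model.mem_cov_prod_right fun x => ?_⟩
    convert add_mem (hC x) (nsmul_mem hr (∑ x, C x - C x)) using 1
    have : C x ≤ ∑ x, C x := Finset.single_le_sum (fun _ _ => Nat.zero_le _) (Finset.mem_univ x)
    rw [add_assoc, ← add_smul, Nat.add_sub_cancel' this]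
    rfl
  exact ⟨aux h fun x => (hh x).1, aux (-h) fun x => (hh x).2⟩

lemma Model.const_mem_cov_of_one_mem_bal {r : ℕ} (hr0 : 0 < r) (hr : const M.U (r : ℤ) ∈ M.cov T)
    (h1 : const M.U 1 ∈ M.bal T r) : ∃ q₀ : ℕ, ∀ q ≥ q₀, const M.U (q : ℤ) ∈ M.cov T := by
  obtain ⟨⟨C, hC⟩, -⟩ := h1
  refine ⟨r * (1 + C * r), fun q hq => ?_⟩
  have h2 : q % r * (1 + C * r) ≤ q :=
    (Nat.mul_le_mul_right _ (Nat.mod_lt _ hr0).le).trans hq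
  obtain ⟨t, ht⟩ : r ∣ q - q % r * (1 + C * r) := by
    refine (Nat.modEq_iff_dvd' h2).1 ?_
    rw [mul_add, mul_one, ← mul_assoc]
    simp [Nat.ModEq]
  have h3 : q = q % r * (1 + C * r) + t * r := by
    rw [mul_comm t, ← ht]; omega
  convert add_mem (nsmul_mem hC (q % r)) (nsmul_mem hr t) using 1
  ext
  have h4 := congrArg (Nat.cast : ℕ → ℤ) h3
  simpa [mul_add] using h4

end Covers

section Torus

variable {k : ℕ} {T : Finset (Fin k → ℤ)}

/-- The colouring of the lattice by residues. -/
abbrev Model.torus (k q : ℕ) [NeZero q] : Model where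
  ι := Fin k
  U := Fin k → ZMod q
  π z i := z i

lemma exists_injOn_torus (T : Finset (Fin k → ℤ)) {p : ℕ} (hp : p.Prime) :
    ∃ a, Set.InjOn (fun (z : Fin k → ℤ) i => (z i : ZMod (p ^ a))) T := by
  let D : ℕ := ∑ x ∈ T, ∑ y ∈ T, ∑ i, (x i - y i).natAbs
  refine ⟨D, fun x hx y hy hxy => funext fun i => ?_⟩
  have h1 : (x i - y i).natAbs ≤ D :=
    calc (x i - y i).natAbs ≤ ∑ i, (x i - y i).natAbs :=
          Finset.single_le_sum (f := fun i => (x i - y i).natAbs) (fun _ _ => Nat.zero_le _)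
            (Finset.mem_univ i)
      _ ≤ ∑ y ∈ T, ∑ i, (x i - y i).natAbs :=
          Finset.single_le_sum (f := fun y => ∑ i, (x i - y i).natAbs)
            (fun _ _ => Nat.zero_le _) hy
      _ ≤ D :=
          Finset.single_le_sum (f := fun x => ∑ y ∈ T, ∑ i, (x i - y i).natAbs)
            (fun _ _ => Nat.zero_le _) hx
  have h2 : ((p ^ D : ℕ) : ℤ) ∣ x i - y i := by
    rw [← ZMod.intCast_zmod_eq_zero_iff_dvd]
    simpa [sub_eq_zero] using congrFun hxy i
  have h3 := Int.eq_zero_of_dvd_of_natAbs_lt_natAbs h2 (by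
    rw [Int.natAbs_natCast]
    exact h1.trans_lt (Nat.lt_pow_self hp.one_lt))
  omega

lemma tileable_of_isCopy {ι : Type*} [Fintype ι] {S : Set (ι → ℤ)} (h : IsCopy T S) :
    Tileable T S :=
  ⟨{S}, by simp, by simp, by simpa using h⟩

variable {q : ℕ} [NeZero q]

lemma Model.tile_torus (hT : Set.InjOn (Model.torus k q).π T) (g : Fin k → ZMod q) :
    (Model.torus k q).tile T {u | ∃ t ∈ T, g + (Model.torus k q).π t = u} := by
  have hadd : ∀ z t, (Model.torus k q).π (z + t) =
      (Model.torus k q).π z + (Model.torus k q).π t := by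
    intro z t; ext; simp
  have : (Model.torus k q).π ⁻¹' {u | ∃ t ∈ T, g + (Model.torus k q).π t = u} =
      ⋃ z : {z // (Model.torus k q).π z = g}, (z.1 + ·) '' T := by
    ext w
    simp only [Set.mem_preimage, Set.mem_ofPred_eq, Set.mem_iUnion, Set.mem_image]
    constructor
    · rintro ⟨t, ht, h⟩
      refine ⟨⟨w - t, ?_⟩, t, ht, sub_add_cancel w t⟩
      rw [eq_sub_of_add_eq h]
      ext; simp
    · rintro ⟨⟨z, hz⟩, t, ht, rfl⟩
      exact ⟨t, ht, ((hadd z t).trans (congrArg (· + _) hz)).symm⟩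
  unfold Model.tile
  rw [this]
  refine Tileable.iUnion ?_ fun z => tileable_of_isCopy ⟨(z.1 + ·), rfl, by simp [sqDist]⟩
  rintro ⟨z, hz⟩ ⟨z', hz'⟩ _ ⟨t, ht, rfl⟩ ⟨t', ht', h⟩
  dsimp only at h
  have h' := congrArg (Model.torus k q).π h
  rw [hadd, hadd, hz, hz', add_right_inj] at h'
  obtain rfl := hT ht' ht h'
  exact Subtype.ext (add_right_cancel h).symm

/-- The indicator function of a translate of `T`. -/
def translate (T : Finset (Fin k → ℤ)) (q : ℕ) [NeZero q] (g u : Fin k → ZMod q) : ℤ :=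
  ∑ t ∈ T, if g + (Model.torus k q).π t = u then 1 else 0

lemma translate_eq_indicator (hT : Set.InjOn (Model.torus k q).π T) (g : Fin k → ZMod q) :
    translate T q g = {u | ∃ t ∈ T, g + (Model.torus k q).π t = u}.indicator 1 := by
  classical
  ext u
  unfold translate
  by_cases h : ∃ t ∈ T, g + (Model.torus k q).π t = u
  · rw [Set.indicator_of_mem (Set.mem_ofPred_eq ▸ h)]
    obtain ⟨t, ht, rfl⟩ := h
    rw [Finset.sum_eq_single t]
    · simp
    · intro s hs hst
      rw [if_neg]
      intro h
      exact hst (hT hs ht (add_left_cancel h))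
    · exact fun h => absurd ht h
  · rw [Set.indicator_of_notMem (by simpa using h)]
    refine Finset.sum_eq_zero fun t ht => if_neg fun h' => h ⟨t, ht, h'⟩

lemma translate_mem_cov (hT : Set.InjOn (Model.torus k q).π T) (g : Fin k → ZMod q) :
    translate T q g ∈ (Model.torus k q).cov T := by
  rw [translate_eq_indicator hT]
  exact Model.indicator_mem_cov (Model.tile_torus hT g)

lemma sum_translate : ∑ g, translate T q g = const _ (T.card : ℤ) := by
  ext u
  simp only [Finset.sum_apply, translate, const_apply]
  rw [Finset.sum_comm]
  simp [← eq_sub_iff_add_eq]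

lemma Model.const_mem_cov_torus (hT : Set.InjOn (Model.torus k q).π T) :
    const _ (T.card : ℤ) ∈ (Model.torus k q).cov T := by
  rw [← sum_translate (q := q)]
  exact sum_mem fun g _ => translate_mem_cov hT g

lemma translate_mem_bal (hT : Set.InjOn (Model.torus k q).π T) (g : Fin k → ZMod q) :
    translate T q g ∈ (Model.torus k q).bal T T.card := by
  classical
  refine ⟨⟨0, by simpa using translate_mem_cov hT g⟩, ⟨1, ?_⟩⟩
  rw [one_smul, ← sum_translate (q := q), ← Finset.add_sum_erase _ _ (Finset.mem_univ g),
    neg_add_cancel_left]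
  exact sum_mem fun g _ => translate_mem_cov hT g

lemma exists_fixed_of_addSubgroup {p a : ℕ} [Fact p.Prime]
    (W : AddSubgroup ((Fin k → ZMod (p ^ a)) → ZMod p))
    (hW : ∀ w ∈ W, ∀ g, (fun u => w (u + g)) ∈ W) (hne : W ≠ ⊥) :
    (1 : (Fin k → ZMod (p ^ a)) → ZMod p) ∈ W := by
  let G := Multiplicative (Fin k → ZMod (p ^ a))
  let _ : MulAction G W :=
    { smul := fun g w => ⟨fun u => w.1 (u + g.toAdd), hW w.1 w.2 _⟩
      one_smul := fun w => Subtype.ext (funext fun u => congrArg w.1 (add_zero u))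
      mul_smul := fun g h w => Subtype.ext (funext fun u => congrArg w.1 (by
        change u + (g.toAdd + h.toAdd) = u + g.toAdd + h.toAdd
        rw [add_assoc])) }
  have hG : IsPGroup p G := by
    refine IsPGroup.of_card (n := a * k) ?_
    rw [Nat.card_congr (Multiplicative.toAdd (α := Fin k → ZMod (p ^ a)))]
    simp [pow_mul]
  have hcard : p ∣ Nat.card W := by
    have h1 : Nat.card W ∣ p ^ Nat.card (Fin k → ZMod (p ^ a)) := by
      convert W.card_addSubgroup_dvd_card using 1
      simp
    obtain ⟨n, -, hn⟩ := (Nat.dvd_prime_pow Fact.out).1 h1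
    rw [hn]
    refine dvd_pow_self p fun h0 => hne ?_
    rw [h0, pow_zero] at hn
    exact AddSubgroup.eq_bot_of_card_eq W hn
  obtain ⟨w, hw, hw0⟩ := hG.exists_fixed_point_of_prime_dvd_card_of_fixed_point W hcard
    (a := 0) fun g => rfl
  have hconst : ∀ u, w.1 u = w.1 0 := fun u => by
    have := congrFun (congrArg Subtype.val (hw (Multiplicative.ofAdd u))) 0
    change w.1 (0 + u) = w.1 0 at this
    rwa [zero_add] at this
  have hc : w.1 0 ≠ 0 := fun h => hw0 (Subtype.ext (funext fun u => by
    rw [hconst, h]; rfl)).symm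
  convert nsmul_mem w.2 (w.1 0)⁻¹.val using 1
  ext u
  simp [hconst u, hc]

lemma exists_one_sub_mem_bal {p a : ℕ} [Fact p.Prime] [NeZero (p ^ a)] (hne : T.Nonempty)
    (hT : Set.InjOn (Model.torus k (p ^ a)).π T) :
    ∃ G : (Fin k → ZMod (p ^ a)) → ℤ,
      (fun u => 1 - p * G u) ∈ (Model.torus k (p ^ a)).bal T T.card := by
  let ρ : ((Fin k → ZMod (p ^ a)) → ℤ) →+ ((Fin k → ZMod (p ^ a)) → ZMod p) :=
    { toFun := fun h u => h u
      map_zero' := by ext; simp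
      map_add' := fun g h => by ext; simp }
  let H := AddSubgroup.closure (Set.range (translate T (p ^ a)))
  have hH : H ≤ (Model.torus k (p ^ a)).bal T T.card := by
    rw [AddSubgroup.closure_le]
    rintro _ ⟨g, rfl⟩
    exact translate_mem_bal hT g
  have hinv : ∀ w ∈ H, ∀ g, (fun u => w (u + g)) ∈ H := by
    intro w hw g
    induction hw using AddSubgroup.closure_induction with
    | mem w hw =>
      obtain ⟨g', rfl⟩ := hw
      refine AddSubgroup.subset_closure ⟨g' - g, ?_⟩
      ext u
      simp only [translate, sub_add_eq_add_sub, sub_eq_iff_eq_add]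
    | zero => exact zero_mem _
    | add v w _ _ hv hw => exact add_mem hv hw
    | neg w _ hw => exact neg_mem hw
  have h1 : (1 : (Fin k → ZMod (p ^ a)) → ZMod p) ∈ H.map ρ := by
    refine exists_fixed_of_addSubgroup _ ?_ ?_
    · rintro _ ⟨w, hw, rfl⟩ g
      exact ⟨_, hinv w hw g, rfl⟩
    · intro hbot
      have hmem : ρ (translate T (p ^ a) 0) ∈ H.map ρ :=
        ⟨_, AddSubgroup.subset_closure ⟨0, rfl⟩, rfl⟩
      rw [hbot, AddSubgroup.mem_bot] at hmem
      obtain ⟨t, ht⟩ := hne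
      have := congrFun hmem ((Model.torus k (p ^ a)).π t)
      rw [translate_eq_indicator hT] at this
      change ((Set.indicator _ _ _ : ℤ) : ZMod p) = 0 at this
      have hmem : (Model.torus k (p ^ a)).π t ∈
          {u | ∃ t ∈ T, (0 : Fin k → ZMod (p ^ a)) + (Model.torus k (p ^ a)).π t = u} :=
        ⟨t, ht, zero_add _⟩
      rw [Set.indicator_of_mem hmem] at this
      simp at this
  obtain ⟨h, hh, h1⟩ := h1
  have hdvd : ∀ u, (p : ℤ) ∣ 1 - h u := fun u => by
    rw [← ZMod.intCast_zmod_eq_zero_iff_dvd]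
    have : ((h u : ℤ) : ZMod p) = 1 := congrFun h1 u
    simp [this]
  choose G hG using hdvd
  refine ⟨G, ?_⟩
  convert hH hh using 1
  ext u
  rw [← hG]
  ring

end Torus

section Induction

variable {k : ℕ} {T : Finset (Fin k → ℤ)}

lemma exists_one_mem_bal_of_const_mem_bal (hne : T.Nonempty) (m : ℕ) (hm : 0 < m) (M : Model)
    (hr : const M.U (T.card : ℤ) ∈ M.cov T) (h : const M.U (m : ℤ) ∈ M.bal T T.card) :
    ∃ M : Model, const M.U (T.card : ℤ) ∈ M.cov T ∧ const M.U 1 ∈ M.bal T T.card := by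
  induction m using Nat.strong_induction_on generalizing M with
  | _ m ih =>
  obtain rfl | hm1 := eq_or_ne m 1
  · exact ⟨M, hr, by simpa using h⟩
  have hp := Nat.minFac_prime hm1
  have : Fact m.minFac.Prime := ⟨hp⟩
  obtain ⟨m', hm'⟩ := m.minFac_dvd
  set p := m.minFac
  have hm0 : 0 < m' := Nat.pos_of_ne_zero fun h => by simp [h] at hm'; omega
  obtain ⟨a, ha⟩ := exists_injOn_torus T hp
  have : NeZero (p ^ a) := ⟨pow_ne_zero _ hp.ne_zero⟩
  have hr' : const _ (T.card : ℤ) ∈ (Model.torus k (p ^ a)).cov T := Model.const_mem_cov_torus ha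
  obtain ⟨G, hG⟩ := exists_one_sub_mem_bal hne ha
  refine ih m' (by rw [hm']; exact lt_mul_left hm0 hp.one_lt) hm0
    (M.prod (Model.torus k (p ^ a))) (Model.mem_cov_prod_left fun _ => hr) ?_
  convert add_mem (Model.mem_bal_prod_right (M := M) (h := fun p' => m' * (1 - p * G p'.2)) hr'
    fun _ => ?_) (Model.mem_bal_prod_left (h := fun p => G p.2 * m) hr fun y => ?_) using 1
  · ext y
    conv_rhs => rw [hm']
    simp only [const_apply, Pi.add_apply]
    push_cast
    ring
  · convert zsmul_mem hG m' using 1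
    ext; simp
  · convert zsmul_mem h (G y) using 1
    ext; simp

lemma exists_model_const_mem_cov (hne : T.Nonempty) :
    ∃ (M : Model) (q₀ : ℕ), ∀ q ≥ q₀, const M.U (q : ℤ) ∈ M.cov T := by
  obtain ⟨a, ha⟩ := exists_injOn_torus T Nat.prime_two
  have hr : const _ (T.card : ℤ) ∈ (Model.torus k (2 ^ a)).cov T := Model.const_mem_cov_torus ha
  obtain ⟨M, hM, h1⟩ := exists_one_mem_bal_of_const_mem_bal hne T.card hne.card_pos _ hr
    ⟨⟨0, by simpa using hr⟩, ⟨1, by simp⟩⟩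
  exact ⟨M, Model.const_mem_cov_of_one_mem_bal hne.card_pos hM h1⟩

end Induction

section Assembly

variable {k : ℕ} {T : Finset (Fin k → ℤ)} {M V : Model}

lemma Model.exists_family_of_mem_cov {g : M.U → ℤ} (h : g ∈ M.cov T) :
    ∃ (I : Type) (_ : Fintype I) (F : I → Set M.U), (∀ i, M.tile T (F i)) ∧
      ∀ x, ∑ i, (F i).indicator (1 : M.U → ℤ) x = g x := by
  induction h using AddSubmonoid.closure_induction with
  | mem g hg =>
    obtain ⟨A, hA, rfl⟩ := hg
    exact ⟨Unit, inferInstance, fun _ => A, fun _ => hA, by simp⟩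
  | zero => exact ⟨Empty, inferInstance, fun _ => ∅, by simp, by simp⟩
  | add g g' _ _ hg hg' =>
    obtain ⟨I, _, F, hF, h⟩ := hg
    obtain ⟨I', _, F', hF', h'⟩ := hg'
    exact ⟨I ⊕ I', inferInstance, Sum.elim F F', by simp [hF, hF'], by simp [h, h']⟩

/-- A cover of constant multiplicity `q` can be labelled so that the tiles containing a given
colour have labels `0, …, q - 1`. -/
lemma Model.exists_labelled_family {q : ℕ} (h : const M.U (q : ℤ) ∈ M.cov T) :
    ∃ (I : Type) (_ : Fintype I) (F : I → Set M.U) (l : I → M.U → ℕ), (∀ i, M.tile T (F i)) ∧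
      (∀ i, ∀ x ∈ F i, l i x < q) ∧ ∀ x, ∀ m < q, ∃! i, x ∈ F i ∧ l i x = m := by
  classical
  obtain ⟨I, _, F, hF, hq⟩ := Model.exists_family_of_mem_cov h
  have hcard : ∀ x, Fintype.card {i // x ∈ F i} = Fintype.card (Fin q) := by
    intro x
    have := hq x
    simp only [Set.indicator_apply, Pi.one_apply, Finset.sum_boole, const_apply,
      Nat.cast_inj] at this
    rw [Fintype.card_subtype, this, Fintype.card_fin]
  let e x := Fintype.equivOfCardEq (hcard x)
  refine ⟨I, inferInstance, F, fun i x => if hx : x ∈ F i then e x ⟨i, hx⟩ else 0, hF, ?_, ?_⟩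
  · intro i x hx
    simp [hx]
  · intro x m hm
    refine ⟨(e x).symm ⟨m, hm⟩, ⟨((e x).symm ⟨m, hm⟩).2, ?_⟩, ?_⟩
    · dsimp only
      rw [dif_pos ((e x).symm ⟨m, hm⟩).2]
      simp
    · rintro i ⟨hi, him⟩
      simp only [hi, dite_true] at him
      rw [(e x).symm_apply_eq.2 (Fin.ext him.symm)]

open Classical in
/-- The word attached to a set `F` of colours with a given labelling. -/
noncomputable def word {U : Type} [Fintype U] (F : Set U) (l : U → ℕ) (s : ZMod 2) :
    Option U → ℕ
  | none => (s * ((Finset.univ.filter (· ∈ F)).card + 1)).val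
  | some u => if u ∈ F then l u else 0

lemma even_sum_word {U : Type} [Fintype U] {F : Set U} {l : U → ℕ} {s : ZMod 2}
    (hl : ∀ u ∈ F, (l u : ZMod 2) = s) [DecidableEq (Option U)] {u : U} (hu : u ∈ F) :
    Even (∑ j ∈ Finset.univ.erase (some u), word F l s j) := by
  classical
  have h1 := congrArg (Nat.cast : ℕ → ZMod 2)
    (Finset.add_sum_erase _ (word F l s) (Finset.mem_univ (some u)))
  have h2 : ∑ x, (word F l s (some x) : ZMod 2) = (Finset.univ.filter (· ∈ F)).card * s := by
    rw [← nsmul_eq_mul, ← Finset.sum_const, Finset.sum_filter]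
    refine Finset.sum_congr rfl fun x _ => ?_
    by_cases hx : x ∈ F <;> simp [word, hx, hl]
  have h3 : (word F l s (some u) : ZMod 2) = s := by simp [word, hu, hl]
  have h4 : (word F l s none : ZMod 2) = s * ((Finset.univ.filter (· ∈ F)).card + 1) := by
    simp [word]
  rw [Fintype.sum_option] at h1
  push_cast at h1
  rw [h2, h3, h4] at h1
  rw [← ZMod.natCast_eq_zero_iff_even]
  push_cast
  have h5 : (2 : ZMod 2) = 0 := rfl
  linear_combination h1 + (s * (Finset.univ.filter (· ∈ F)).card) * h5

/-- Each tile `F i` is multiplied by the cells spelling its word; what remains over a colour `x`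
is, for each letter, a product of cells minus one cell whose word has an even sum. -/
lemma tile_univ_of_labelled_family {c : V.U → ℕ} {L : ℕ} (hc : IsPath T V c L) (hL : Odd L)
    (hL1 : 1 < L) {I : Type} {F : I → Set M.U} {l : I → M.U → ℕ} {s : I → ZMod 2}
    (hF : ∀ i, M.tile T (F i)) (hlt : ∀ i, ∀ x ∈ F i, l i x < L)
    (hl : ∀ x, ∀ m < L, ∃! i, x ∈ F i ∧ l i x = m)
    (hs : ∀ i, ∀ x ∈ F i, (l i x : ZMod 2) = s i) :
    (M.prod (V.pow (Option M.U))).tile T Set.univ := by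
  classical
  let w (i : I) := word (F i) (l i) (s i)
  have hw : ∀ i j, w i j < L := by
    rintro i (_ | u)
    · exact (ZMod.val_lt _).trans_le hL1
    · by_cases hu : u ∈ F i
      · simpa [w, word, hu] using hlt i u hu
      · simp only [w, word, hu, if_false]
        omega
  have hwl : ∀ i, ∀ x ∈ F i, w i (some x) = l i x := fun i x hx => by simp [w, word, hx]
  let A : Set (M.U × (Option M.U → V.U)) := {p | ∃ i, p.1 ∈ F i ∧ ∀ j, c (p.2 j) = w i j}
  rw [← Set.union_compl_self A]
  refine Model.tile_union (Model.tile_prod_left fun f => ?_) (Model.tile_prod_right fun x => ?_)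
    fun x hx hx' => hx' hx
  · have : {x | (x, f) ∈ A} = ⋃ i : {i // ∀ j, c (f j) = w i j}, F i.1 := by
      ext x
      simp [A, and_comm]
    rw [this]
    refine Model.tile_iUnion ?_ fun i => hF i
    rintro ⟨i, hi⟩ ⟨i', hi'⟩ x hx hx'
    refine Subtype.ext ((hl x _ (hc.lt (f (some x)))).unique ⟨hx, ?_⟩ ⟨hx', ?_⟩)
    · rw [hi, hwl i x hx]
    · rw [hi', hwl i' x hx']
  · refine Model.tile_of_fiber (fun f : Option M.U → V.U => c (f (some x))) fun m => ?_
    obtain hm | hm := lt_or_ge m L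
    · obtain ⟨i, ⟨hi, rfl⟩, huniq⟩ := hl x m hm
      convert hc.tile_pow_exists_ne hL (hw i) _ (even_sum_word (hs i) hi)
        {f | c (f (some x)) = l i x} ?_ using 1
      · ext f
        simp only [A, Set.mem_ofPred_eq, Set.mem_compl_iff, Finset.mem_erase, Finset.mem_univ,
          and_true]
        constructor
        · rintro ⟨h1, h2⟩
          refine ⟨h2, ?_⟩
          by_contra! h3
          refine h1 ⟨i, hi, fun j => ?_⟩
          by_cases hj : j = some x
          · rw [hj, h2, hwl i x hi]
          · exact h3 j hj
        · rintro ⟨h2, j, -, hj⟩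
          refine ⟨?_, h2⟩
          rintro ⟨i', hi', h3⟩
          obtain rfl := huniq i' ⟨hi', by rw [← hwl i' x hi', ← h3, h2]⟩
          exact hj (h3 j)
      · intro j hj f u
        simp [(Finset.ne_of_mem_erase hj).symm]
    · convert Model.tile_empty using 1
      ext f
      have := hc.lt (f (some x))
      simp only [Set.mem_ofPred_eq, Set.mem_empty_iff_false, iff_false]
      omega

lemma exists_tileable_univ (hne : T.Nonempty) :
    ∃ (ι : Type) (_ : Fintype ι), Tileable T (Set.univ : Set (ι → ℤ)) := by
  obtain ⟨M, q₀, hM⟩ := exists_model_const_mem_cov hne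
  have hcov : ∀ u, ∃ A, u ∈ A ∧ M.tile T A := by
    obtain ⟨I, _, F, l, hF, -, h⟩ := Model.exists_labelled_family (hM (q₀ + 1) (by omega))
    intro u
    obtain ⟨i, ⟨hi, -⟩, -⟩ := h u 0 (by omega)
    exact ⟨F i, hi, hF i⟩
  have hodd : Odd (3 ^ (2 * q₀ + 1)) := Odd.pow (by decide)
  obtain ⟨V, c, hc⟩ := exists_isPath_three_pow hcov (2 * q₀ + 1)
  have hlt : 2 * q₀ + 1 < 3 ^ (2 * q₀ + 1) := Nat.lt_pow_self (by norm_num)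
  obtain ⟨β, hβ⟩ := id hodd
  obtain ⟨I, _, F, l, hF, hl, hu⟩ := Model.exists_labelled_family (hM (β + 1) (by omega))
  obtain ⟨I', _, F', l', hF', hl', hu'⟩ := Model.exists_labelled_family (hM β (by omega))
  refine ⟨_, _, tile_univ_of_labelled_family (I := I ⊕ I') (F := Sum.elim F F')
    (l := Sum.elim (fun i x => 2 * l i x) fun i x => 2 * l' i x + 1)
    (s := Sum.elim (fun _ => 0) fun _ => 1) hc hodd (by omega) ?_ ?_ ?_ ?_⟩
  · rintro (i | i)
    exacts [hF i, hF' i]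
  · rintro (i | i) x hx
    · have := hl i x hx
      simp only [Sum.elim_inl]
      omega
    · have := hl' i x hx
      simp only [Sum.elim_inr]
      omega
  · intro x m hm
    obtain ⟨n, rfl | rfl⟩ := Nat.even_or_odd' m
    · obtain ⟨i, ⟨hi, him⟩, hi'⟩ := hu x n (by omega)
      refine ⟨.inl i, ⟨hi, by simp [him]⟩, ?_⟩
      rintro (j | j) ⟨hj, hjm⟩
      · rw [hi' j ⟨hj, by simpa using hjm⟩]
      · simp only [Sum.elim_inr] at hjm
        omega
    · obtain ⟨i, ⟨hi, him⟩, hi'⟩ := hu' x n (by omega)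
      refine ⟨.inr i, ⟨hi, by simp [him]⟩, ?_⟩
      rintro (j | j) ⟨hj, hjm⟩
      · simp only [Sum.elim_inl] at hjm
        omega
      · rw [hi' j ⟨hj, by simpa using hjm⟩]
  · have h2 : (2 : ZMod 2) = 0 := rfl
    rintro (i | i) x hx <;> simp [h2]

lemma exists_forall_tileable_univ (hne : T.Nonempty) :
    ∃ n₀, ∀ n, n₀ ≤ n → Tileable T (Set.univ : Set (Fin n → ℤ)) := by
  obtain ⟨ι, _, h⟩ := exists_tileable_univ hne
  refine ⟨Fintype.card ι, fun n hn => ?_⟩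
  let φ : ι ⊕ Fin (n - Fintype.card ι) ≃ Fin n := Fintype.equivOfCardEq (by
    simp only [Fintype.card_sum, Fintype.card_fin]
    omega)
  refine Tileable.of_sections (e := fun (z : Fin (n - Fintype.card ι) → ℤ) (x : ι → ℤ) =>
    Sum.elim x z ∘ φ.symm) ?_ ?_ ?_ fun _ => h
  · intro z x y
    unfold sqDist
    rw [← φ.sum_comp]
    simp
  · intro w
    refine ⟨w ∘ φ ∘ Sum.inr, w ∘ φ ∘ Sum.inl, ?_⟩
    ext j
    obtain ⟨i | i, rfl⟩ := φ.surjective j <;> simp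
  · intro z z' x x' h
    ext i
    simpa using congrFun h (φ (.inr i))

end Assembly

section Euclidean

/-- The inclusion of the integer lattice in Euclidean space. -/
noncomputable def toEuclidean {n : ℕ} (z : Fin n → ℤ) : EuclideanSpace ℝ (Fin n) :=
  WithLp.toLp 2 fun i => (z i : ℝ)

lemma dist_toEuclidean {n : ℕ} (x y : Fin n → ℤ) :
    dist (toEuclidean x) (toEuclidean y) = √(sqDist x y) := by
  simp [EuclideanSpace.dist_eq, toEuclidean, sqDist, Real.dist_eq, sq_abs]

lemma toEuclidean_injective {n : ℕ} : Injective (toEuclidean (n := n)) := by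
  intro x y h
  ext i
  have := congrArg (· i) h
  simpa [toEuclidean] using this

lemma range_toEuclidean {n : ℕ} :
    Set.range (toEuclidean (n := n)) = {x | ∀ i, ∃ z : ℤ, x i = (z : ℝ)} := by
  ext x
  constructor
  · rintro ⟨z, rfl⟩ i
    exact ⟨z i, rfl⟩
  · intro h
    choose z hz using h
    refine ⟨z, ?_⟩
    ext i
    simp [toEuclidean, hz]

end Euclidean

end LatticeTiling

theorem integer_lattice_partition_into_isometric_copies (k : ℕ) (hk : 1 ≤ k)
    (T : Set (EuclideanSpace ℝ (Fin k))) (hTfin : T.Finite) (hTne : T.Nonempty)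
    (hTint : ∀ x ∈ T, ∀ i : Fin k, ∃ z : ℤ, x i = (z : ℝ)) :
    ∃ n₀ : ℕ, ∀ n, n₀ ≤ n →
      ∃ P : Set (Set (EuclideanSpace ℝ (Fin n))),
        ⋃₀ P = {x : EuclideanSpace ℝ (Fin n) | ∀ i : Fin n, ∃ z : ℤ, x i = (z : ℝ)} ∧
        P.PairwiseDisjoint id ∧
        ∀ S ∈ P, ∃ f : T → S, Function.Bijective f ∧
          ∀ x y : T,
            dist (f x : EuclideanSpace ℝ (Fin n)) (f y : EuclideanSpace ℝ (Fin n)) =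
              dist (x : EuclideanSpace ℝ (Fin k)) (y : EuclideanSpace ℝ (Fin k)) := by
  open LatticeTiling in
  have hfin : (toEuclidean ⁻¹' T).Finite := hTfin.preimage toEuclidean_injective.injOn
  have hT : ∀ t : T, ∃ z ∈ hfin.toFinset, toEuclidean z = t := by
    rintro ⟨t, ht⟩
    obtain ⟨z, rfl⟩ := (range_toEuclidean (n := k)).ge (hTint t ht)
    exact ⟨z, by simpa using ht, rfl⟩
  have hne : hfin.toFinset.Nonempty := by
    obtain ⟨t, ht⟩ := hTne
    obtain ⟨z, hz, -⟩ := hT ⟨t, ht⟩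
    exact ⟨z, hz⟩
  choose z hz hzt using hT
  obtain ⟨n₀, h⟩ := exists_forall_tileable_univ hne
  refine ⟨n₀, fun n hn => ?_⟩
  obtain ⟨P, hP, hd, hc⟩ := h n hn
  refine ⟨(toEuclidean '' ·) '' P, ?_, ?_, ?_⟩
  · rw [← range_toEuclidean, ← Set.image_univ, ← hP, Set.sUnion_image, Set.sUnion_eq_biUnion,
      Set.image_iUnion₂]
  · rintro _ ⟨s, hs, rfl⟩ _ ⟨t, ht, rfl⟩ hst
    have hne : s ≠ t := fun h => hst (by rw [h])
    exact (Set.disjoint_image_iff toEuclidean_injective).2 (hd hs ht hne)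
  · rintro _ ⟨_, hs, rfl⟩
    obtain ⟨f, rfl, hf⟩ := hc _ hs
    have hdist : ∀ x y : T, dist (toEuclidean (f (z x))) (toEuclidean (f (z y))) =
        dist (x : EuclideanSpace ℝ (Fin k)) y := by
      intro x y
      rw [dist_toEuclidean, hf _ (hz x) _ (hz y), ← dist_toEuclidean, hzt, hzt]
    refine ⟨fun x => ⟨toEuclidean (f (z x)), _, ⟨_, hz x, rfl⟩, rfl⟩, ⟨?_, ?_⟩, hdist⟩
    · intro x y hxy
      have := congrArg Subtype.val hxy
      exact Subtype.ext (dist_eq_zero.1 (by rw [← hdist]; exact dist_eq_zero.2 this))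
    · rintro ⟨_, _, ⟨w, hw, rfl⟩, rfl⟩
      refine ⟨⟨toEuclidean w, by simpa using hw⟩, Subtype.ext ?_⟩
      exact congrArg (toEuclidean ∘ f) (toEuclidean_injective (hzt _))
end
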